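/- arXiv:1202.4285 — 10 statements merged into one kernel-verified Lean document; each statement's English description precedes it below -/
import Mathlib

section
/- Let p > 3 be a prime and let A, B ∈ 𝔽_p satisfy B(A² − 4) ≠ 0. Let W_{A,B} be the elliptic curve Y² = X³ + (AB)X² + B²X over 𝔽_p. If p ≡ 3 (mod 4) and A² − 4 is a square in 𝔽_p, then the 4-torsion subgroup {P ∈ W_{A,B}(𝔽_p) : 4•P = O} is isomorphic as an abelian group to ℤ/2ℤ × ℤ/4ℤ. -/
open WeierstrassCurve

/-- The `m`-torsion subgroup of an additive commutative group. -/
def torsionSubgroup (G : Type*) [AddCommGroup G] (m : ℕ) : AddSubgroup G where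
  carrier := {P | m • P = 0}
  zero_mem' := smul_zero m
  add_mem' := fun {a b} (ha : m • a = 0) (hb : m • b = 0) => by
    show m • (a + b) = 0
    rw [smul_add, ha, hb, add_zero]
  neg_mem' := fun {a} (ha : m • a = 0) => by
    show m • (-a) = 0
    rw [smul_neg, ha, neg_zero]

/-- If `a, b, c` are the nonzero `2`-torsion elements of an additive commutative group and `a` is the
only one of them divisible by `2`, then the `4`-torsion is isomorphic to `ℤ/2ℤ × ℤ/4ℤ`. -/
theorem nonempty_torsionSubgroup_four_addEquiv {G : Type*} [AddCommGroup G] {a b c P : G}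
    (ha : a ≠ 0) (hb : b ≠ 0) (hab : a ≠ b)
    (htors : ∀ x : G, 2 • x = 0 ↔ x = 0 ∨ x = a ∨ x = b ∨ x = c)
    (hP : 2 • P = a) (hbQ : ∀ Q : G, 2 • Q ≠ b) (hcQ : ∀ Q : G, 2 • Q ≠ c) :
    Nonempty (torsionSubgroup G 4 ≃+ (ZMod 2 × ZMod 4)) := by
  have ha2 : 2 • a = 0 := by simp [htors]
  have hb2 : 2 • b = 0 := by simp [htors]
  have hP4 : 4 • P = 0 := by rw [show 4 = 2 * 2 from rfl, mul_nsmul, hP, ha2]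
  have hsum : a + b = c := by
    have h := (htors (a + b)).1 (by rw [nsmul_add, ha2, hb2, add_zero])
    rcases h with h | h | h | h
    · refine absurd ?_ hab
      rw [eq_neg_of_add_eq_zero_left h, neg_eq_iff_add_eq_zero, ← two_nsmul, hb2]
    · exact absurd (by simpa using h) hb
    · exact absurd (by simpa using h) ha
    · exact h
  let f : ZMod 2 × ZMod 4 →+ G := AddMonoidHom.coprod
    (ZMod.lift 2 ⟨zmultiplesHom G b, by simp [ofNat_zsmul, hb2]⟩)
    (ZMod.lift 4 ⟨zmultiplesHom G P, by simp [ofNat_zsmul, hP4]⟩)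
  have hf (m n : ℤ) : f (m, n) = m • b + n • P := by
    simp only [f, AddMonoidHom.coprod_apply, ZMod.lift_coe, zmultiplesHom_apply]
  have hmem (x : ZMod 2 × ZMod 4) : f x ∈ torsionSubgroup G 4 := by
    show 4 • f x = 0
    rw [← map_nsmul, show 4 • x = 0 by revert x; decide, map_zero]
  refine ⟨(AddEquiv.ofBijective (f.codRestrict _ hmem) ⟨?_, ?_⟩).symm⟩
  · rw [injective_iff_map_eq_zero]
    rintro ⟨i, j⟩ h
    replace h : f (i, j) = 0 := congrArg Subtype.val h
    obtain ⟨m, rfl⟩ := ZMod.intCast_surjective i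
    obtain ⟨n, rfl⟩ := ZMod.intCast_surjective j
    have h2 : n • a = 0 := by
      have := congrArg (2 • ·) h
      simp only [hf, nsmul_add, smul_comm 2 m b, smul_comm 2 n P, hb2, hP] at this
      simpa using this
    have hn : Even n := by
      by_contra hn
      obtain ⟨k, rfl⟩ := Int.not_even_iff_odd.1 hn
      rw [add_smul, one_smul, mul_comm, mul_smul, ofNat_zsmul, ha2] at h2
      exact ha (by simpa using h2)
    obtain ⟨k, rfl⟩ := hn.two_dvd
    rw [hf, mul_comm 2 k, mul_smul, ofNat_zsmul, hP] at h
    obtain ⟨r, rfl | rfl⟩ := Int.even_or_odd' m <;> obtain ⟨s, rfl | rfl⟩ := Int.even_or_odd' k <;>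
      simp only [add_smul, one_smul, mul_comm (2 : ℤ), mul_smul, ofNat_zsmul, ha2, hb2, smul_zero,
        zero_add, add_zero] at h
    · rw [Prod.mk_eq_zero, ZMod.intCast_zmod_eq_zero_iff_dvd, ZMod.intCast_zmod_eq_zero_iff_dvd]
      omega
    · exact absurd h ha
    · exact absurd h hb
    · refine absurd (hsum ▸ (add_comm b a ▸ h) : c = 0) fun hc => hcQ 0 (by rw [hc, nsmul_zero])
  · rintro ⟨Q, hQ⟩
    replace hQ : 4 • Q = 0 := hQ
    suffices ∃ m n : ℤ, m • b + n • P = Q by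
      obtain ⟨m, n, h⟩ := this
      exact ⟨(m, n), Subtype.ext ((hf m n).trans h)⟩
    have hcase {R : G} (hR : 2 • R = 0) : ∃ m n : ℤ, m • b + n • P = R := by
      have h2P : (2 : ℤ) • P = a := by rw [ofNat_zsmul, hP]
      rcases (htors R).1 hR with rfl | rfl | rfl | rfl
      · exact ⟨0, 0, by simp⟩
      · exact ⟨0, 2, by simp [h2P]⟩
      · exact ⟨1, 0, by simp⟩
      · exact ⟨1, 2, by rw [h2P, one_smul, add_comm, hsum]⟩
    rcases (htors (2 • Q)).1 (by rw [← mul_nsmul, hQ]) with h | h | h | h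
    · exact hcase h
    · obtain ⟨m, n, h'⟩ := hcase (R := Q - P) (by rw [nsmul_sub, h, hP, sub_self])
      exact ⟨m, n + 1, by rw [add_smul, one_smul, ← add_assoc, h', sub_add_cancel]⟩
    · exact absurd h (hbQ Q)
    · exact absurd h (hcQ Q)

namespace WeierstrassCurve.Affine

/-- The Weierstrass curve `Y² = (X - e₁)(X - e₂)(X - e₃)`. -/
def ofRoots {R : Type*} [CommRing R] (e₁ e₂ e₃ : R) : WeierstrassCurve.Affine R :=
  ⟨0, -(e₁ + e₂ + e₃), 0, e₁ * e₂ + e₁ * e₃ + e₂ * e₃, -(e₁ * e₂ * e₃)⟩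

section Field

variable {F : Type*} [Field F] {e₁ e₂ e₃ : F}

theorem ofRoots_swap (e₁ e₂ e₃ : F) : ofRoots e₁ e₂ e₃ = ofRoots e₂ e₁ e₃ := by
  simp only [ofRoots]
  congr 1 <;> ring

theorem ofRoots_rotate (e₁ e₂ e₃ : F) : ofRoots e₁ e₂ e₃ = ofRoots e₃ e₁ e₂ := by
  simp only [ofRoots]
  congr 1 <;> ring

theorem equation_ofRoots_iff {x y : F} :
    (ofRoots e₁ e₂ e₃).Equation x y ↔ y ^ 2 = (x - e₁) * (x - e₂) * (x - e₃) := by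
  rw [equation_iff', ← sub_eq_zero (a := y ^ 2)]
  simp only [ofRoots]
  ring_nf

theorem nonsingular_ofRoots_root (h₁₂ : e₁ ≠ e₂) (h₁₃ : e₁ ≠ e₃) :
    (ofRoots e₁ e₂ e₃).Nonsingular e₁ 0 := by
  refine (nonsingular_iff' ..).2 ⟨equation_ofRoots_iff.2 (by ring), Or.inl ?_⟩
  convert neg_ne_zero.2 (mul_ne_zero (sub_ne_zero.2 h₁₂) (sub_ne_zero.2 h₁₃)) using 1
  simp only [ofRoots]
  ring

theorem negY_ofRoots (x y : F) : (ofRoots e₁ e₂ e₃).negY x y = -y := by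
  simp [negY, ofRoots]

variable [DecidableEq F]

theorem two_nsmul_some_ofRoots_eq_zero_iff (h2 : (2 : F) ≠ 0) {x y : F}
    (h : (ofRoots e₁ e₂ e₃).Nonsingular x y) : 2 • Point.some x y h = 0 ↔ y = 0 := by
  rw [two_nsmul]
  constructor
  · intro h0
    by_contra hy
    rw [Point.add_self_of_Y_ne fun hy' => hy ?_] at h0
    · exact Point.some_ne_zero _ h0
    · rw [negY_ofRoots] at hy'
      exact (mul_eq_zero.1 (by linear_combination hy' : 2 * y = 0)).resolve_left h2
  · rintro rfl
    exact Point.add_self_of_Y_eq (by rw [negY_ofRoots, neg_zero])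

theorem two_nsmul_ofRoots_eq_zero_iff (h2 : (2 : F) ≠ 0)
    (h₁ : (ofRoots e₁ e₂ e₃).Nonsingular e₁ 0) (h₂ : (ofRoots e₁ e₂ e₃).Nonsingular e₂ 0)
    (h₃ : (ofRoots e₁ e₂ e₃).Nonsingular e₃ 0) (P : (ofRoots e₁ e₂ e₃).Point) :
    2 • P = 0 ↔ P = 0 ∨ P = .some e₁ 0 h₁ ∨ P = .some e₂ 0 h₂ ∨ P = .some e₃ 0 h₃ := by
  rcases P with _ | ⟨x, y, h⟩
  · exact iff_of_true (nsmul_zero 2) (Or.inl rfl)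
  · rw [two_nsmul_some_ofRoots_eq_zero_iff h2]
    simp only [Point.some_ne_zero, false_or, Point.some.injEq]
    have heq := equation_ofRoots_iff.1 h.1
    constructor
    · rintro rfl
      rw [zero_pow two_ne_zero, zero_eq_mul, mul_eq_zero] at heq
      simp only [sub_eq_zero] at heq
      tauto
    · rintro (h | h | h) <;> exact h.2

/-- The doubling formula on `Y² = (X - e₁)(X - e₂)(X - e₃)`, in terms of the tangent slope `ℓ`. -/
theorem two_nsmul_some_ofRoots (h2 : (2 : F) ≠ 0) {x y ℓ : F}
    (h : (ofRoots e₁ e₂ e₃).Nonsingular x y) (hy : y ≠ 0)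
    (hℓ : 2 * y * ℓ = (x - e₁) * (x - e₂) + (x - e₁) * (x - e₃) + (x - e₂) * (x - e₃)) :
    ∃ h', 2 • Point.some x y h =
      .some (ℓ ^ 2 + e₁ + e₂ + e₃ - 2 * x) (-(ℓ * (ℓ ^ 2 + e₁ + e₂ + e₃ - 3 * x) + y)) h' := by
  have hy' : y ≠ (ofRoots e₁ e₂ e₃).negY x y := by
    rw [negY_ofRoots]
    intro hy'
    exact hy ((mul_eq_zero.1 (by linear_combination hy' : 2 * y = 0)).resolve_left h2)
  have hs : (ofRoots e₁ e₂ e₃).slope x x y y = ℓ := by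
    rw [slope_of_Y_ne rfl hy', div_eq_iff (sub_ne_zero.2 hy'), negY_ofRoots]
    simp only [ofRoots]
    linear_combination -hℓ
  have hX : (ofRoots e₁ e₂ e₃).addX x x ℓ = ℓ ^ 2 + e₁ + e₂ + e₃ - 2 * x := by
    simp only [addX, ofRoots]
    ring
  have hY : (ofRoots e₁ e₂ e₃).addY x x y ℓ =
      -(ℓ * (ℓ ^ 2 + e₁ + e₂ + e₃ - 3 * x) + y) := by
    rw [addY, negY_ofRoots, negAddY, hX]
    ring
  have hadd := nonsingular_add h h fun hxy => hy' hxy.2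
  rw [hs, hX, hY] at hadd
  refine ⟨hadd, ?_⟩
  rw [two_nsmul, Point.add_self_of_Y_ne hy', Point.some.injEq, hs]
  exact ⟨hX, hY⟩

theorem exists_two_nsmul_eq_of_isSquare (h2 : (2 : F) ≠ 0) (h₁₂ : e₁ ≠ e₂) (h₁₃ : e₁ ≠ e₃)
    (h₂₃ : e₂ ≠ e₃) (hs₂ : IsSquare (e₁ - e₂)) (hs₃ : IsSquare (e₁ - e₃))
    (h : (ofRoots e₁ e₂ e₃).Nonsingular e₁ 0) :
    ∃ P : (ofRoots e₁ e₂ e₃).Point, 2 • P = .some e₁ 0 h := by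
  obtain ⟨s, hs⟩ := hs₂
  obtain ⟨t, ht⟩ := hs₃
  have hs0 : s ≠ 0 := by rintro rfl; exact h₁₂ (by linear_combination hs)
  have ht0 : t ≠ 0 := by rintro rfl; exact h₁₃ (by linear_combination ht)
  have hst : s + t ≠ 0 := fun hst => h₂₃ (by linear_combination ht - hs + (t - s) * hst)
  obtain rfl : e₂ = e₁ - s * s := by linear_combination -hs
  obtain rfl : e₃ = e₁ - t * t := by linear_combination -ht
  have hy : s * t * (s + t) ≠ 0 := mul_ne_zero (mul_ne_zero hs0 ht0) hst
  have hP : (ofRoots e₁ (e₁ - s * s) (e₁ - t * t)).Nonsingular (e₁ + s * t) (s * t * (s + t)) := by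
    refine (nonsingular_iff' ..).2 ⟨equation_ofRoots_iff.2 (by ring), Or.inr ?_⟩
    simpa [ofRoots] using ⟨h2, ⟨hs0, ht0⟩, hst⟩
  obtain ⟨h', hP'⟩ := two_nsmul_some_ofRoots (ℓ := s + t) h2 hP hy (by ring)
  refine ⟨_, hP'.trans ?_⟩
  rw [Point.some.injEq]
  constructor <;> ring

theorem isSquare_of_two_nsmul_eq {W : WeierstrassCurve.Affine F} (hW : W = ofRoots e₁ e₂ e₃)
    (h2 : (2 : F) ≠ 0) (h : W.Nonsingular e₁ 0) {P : W.Point} (hP : 2 • P = .some e₁ 0 h) :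
    IsSquare (e₁ - e₂) := by
  subst hW
  rcases P with _ | ⟨x, y, hxy⟩
  · exact absurd (hP.symm.trans (nsmul_zero 2)) (Point.some_ne_zero h)
  have hy : y ≠ 0 := fun hy =>
    Point.some_ne_zero h (hP.symm.trans ((two_nsmul_some_ofRoots_eq_zero_iff h2 hxy).2 hy))
  have heq := equation_ofRoots_iff.1 hxy.1
  have hx : e₂ - x ≠ 0 := by
    intro hx
    refine hy (pow_eq_zero_iff two_ne_zero |>.1 ?_)
    linear_combination heq - (x - e₁) * (x - e₃) * hx
  obtain ⟨ℓ, hℓ⟩ : ∃ ℓ, 2 * y * ℓ =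
      (x - e₁) * (x - e₂) + (x - e₁) * (x - e₃) + (x - e₂) * (x - e₃) :=
    ⟨_, mul_div_cancel₀ _ (mul_ne_zero h2 hy)⟩
  obtain ⟨h', h''⟩ := two_nsmul_some_ofRoots h2 hxy hy hℓ
  rw [h'', Point.some.injEq] at hP
  refine ⟨(y + ℓ * (e₂ - x)) / (e₂ - x), ?_⟩
  rw [div_mul_div_comm, eq_div_iff (mul_ne_zero hx hx)]
  linear_combination -heq - (e₂ - x) * hℓ - (e₂ - x) ^ 2 * hP.1

theorem nonempty_torsionSubgroup_four_ofRoots_addEquiv (hneg : ¬IsSquare (-1 : F))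
    (h₁₂ : e₁ ≠ e₂) (h₁₃ : e₁ ≠ e₃) (h₂₃ : e₂ ≠ e₃)
    (hs₂ : IsSquare (e₁ - e₂)) (hs₃ : IsSquare (e₁ - e₃)) :
    Nonempty (torsionSubgroup (ofRoots e₁ e₂ e₃).Point 4 ≃+ (ZMod 2 × ZMod 4)) := by
  have h2 : (2 : F) ≠ 0 := fun h2 => hneg ⟨1, by linear_combination -h2⟩
  have hnot {x y : F} (hxy : x ≠ y) (h : IsSquare (x - y)) : ¬IsSquare (y - x) := fun h' => by
    have h'' := h'.div h
    rw [← neg_sub x y, neg_div, div_self (sub_ne_zero.2 hxy)] at h''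
    exact hneg h''
  have n₁ := nonsingular_ofRoots_root h₁₂ h₁₃
  have n₂ : (ofRoots e₁ e₂ e₃).Nonsingular e₂ 0 := by
    rw [ofRoots_swap]
    exact nonsingular_ofRoots_root h₁₂.symm h₂₃
  have n₃ : (ofRoots e₁ e₂ e₃).Nonsingular e₃ 0 := by
    rw [ofRoots_rotate]
    exact nonsingular_ofRoots_root h₁₃.symm h₂₃.symm
  obtain ⟨P, hP⟩ := exists_two_nsmul_eq_of_isSquare h2 h₁₂ h₁₃ h₂₃ hs₂ hs₃ n₁
  refine nonempty_torsionSubgroup_four_addEquiv (b := .some e₂ 0 n₂) (Point.some_ne_zero n₁)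
    (Point.some_ne_zero n₂) (by simpa using h₁₂) (two_nsmul_ofRoots_eq_zero_iff h2 n₁ n₂ n₃) hP
    (fun Q hQ => hnot h₁₂ hs₂ (isSquare_of_two_nsmul_eq (ofRoots_swap ..) h2 n₂ hQ))
    (fun Q hQ => hnot h₁₃ hs₃ (isSquare_of_two_nsmul_eq (ofRoots_rotate ..) h2 n₃ hQ))

end Field

end WeierstrassCurve.Affine

theorem FiniteField.isSquare_or_isSquare_neg {F : Type*} [Field F] [Fintype F] [DecidableEq F]
    (hneg : ¬IsSquare (-1 : F)) (x : F) : IsSquare x ∨ IsSquare (-x) := by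
  by_contra! h
  simp only [← quadraticChar_neg_one_iff_not_isSquare] at h hneg
  obtain ⟨h, h'⟩ := h
  rw [neg_eq_neg_one_mul, map_mul, hneg, h] at h'
  exact absurd h' (by decide)

/-- For a prime `p > 3` with `p ≡ 3 (mod 4)`, a Montgomery curve
(in Weierstrass form `Y² = X³ + (AB)X² + B²X`) with `A² − 4` a square mod `p` has
`4`-torsion subgroup isomorphic to `ℤ/2ℤ × ℤ/4ℤ`. -/
theorem montgomery_four_torsion_of_three_mod_four
    (p : ℕ) [Fact (Nat.Prime p)] (hp : 3 < p) (A B : ZMod p)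
    (hAB : B * (A ^ 2 - 4) ≠ 0) (hp4 : p % 4 = 3) (hsq : IsSquare (A ^ 2 - 4))
    (W : WeierstrassCurve (ZMod p)) (hW : W = ⟨0, A * B, 0, B ^ 2, 0⟩) :
    Nonempty ((torsionSubgroup W.toAffine.Point 4) ≃+ (ZMod 2 × ZMod 4)) := by
  have hneg : ¬IsSquare (-1 : ZMod p) := by simpa [ZMod.exists_sq_eq_neg_one_iff] using hp4
  have h2 : (2 : ZMod p) ≠ 0 := fun h2 => hneg ⟨1, by linear_combination -h2⟩
  obtain ⟨d, hd⟩ := hsq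
  have hB : B ≠ 0 := left_ne_zero_of_mul hAB
  have hd0 : d ≠ 0 := fun h => right_ne_zero_of_mul hAB (by rw [hd, h, zero_mul])
  obtain ⟨r, hr⟩ : ∃ r, 2 * r = B * (d - A) := ⟨_, mul_div_cancel₀ _ h2⟩
  obtain ⟨s, hs⟩ : ∃ s, 2 * s = B * (-d - A) := ⟨_, mul_div_cancel₀ _ h2⟩
  have hadd : -(r + s) = A * B :=
    mul_left_cancel₀ h2 (by linear_combination -hr - hs)
  have hmul : r * s = B ^ 2 := mul_left_cancel₀ (mul_ne_zero h2 h2) (by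
    linear_combination 2 * s * hr + B * (d - A) * hs + B ^ 2 * hd)
  have hrs : r ≠ s := fun h => mul_ne_zero hB hd0
    (mul_left_cancel₀ h2 (by linear_combination hs - hr + 2 * h))
  have hr0 : r ≠ 0 := by rintro rfl; exact pow_ne_zero 2 hB (by rw [← hmul, zero_mul])
  have hs0 : s ≠ 0 := by rintro rfl; exact pow_ne_zero 2 hB (by rw [← hmul, mul_zero])
  have hWrs : W = Affine.ofRoots 0 r s := by
    rw [hW, Affine.ofRoots]
    congr 1
    · rw [← hadd]; ring
    · rw [← hmul]; ring
    · ring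
  have hsr : s = B ^ 2 / r := by rw [← hmul, mul_div_cancel_left₀ _ hr0]
  rw [hWrs, toAffine]
  rcases FiniteField.isSquare_or_isSquare_neg hneg r with h | h
  · have hs_sq : IsSquare s := hsr ▸ (IsSquare.sq B).div h
    rcases FiniteField.isSquare_or_isSquare_neg hneg (r - s) with h' | h'
    · rw [Affine.ofRoots_swap]
      exact Affine.nonempty_torsionSubgroup_four_ofRoots_addEquiv hneg hr0 hrs hs0.symm
        (by rwa [sub_zero]) h'
    · rw [Affine.ofRoots_rotate]
      exact Affine.nonempty_torsionSubgroup_four_ofRoots_addEquiv hneg hs0 hrs.symm hr0.symm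
        (by rwa [sub_zero]) (by rwa [neg_sub] at h')
  · have hs_sq : IsSquare (-s) := by
      rw [hsr, ← div_neg]
      exact (IsSquare.sq B).div h
    exact Affine.nonempty_torsionSubgroup_four_ofRoots_addEquiv hneg hr0.symm hs0.symm hrs
      (by rwa [zero_sub]) (by rwa [zero_sub])
end

section
/- Let p > 3 be a prime and let A, B ∈ 𝔽_p satisfy B(A² − 4) ≠ 0. Let W_{A,B} be the elliptic curve Y² = X³ + (AB)X² + B²X over 𝔽_p. If p ≡ 1 (mod 4), (A+2)/B is a square in 𝔽_p, and A² − 4 is a square in 𝔽_p, then W_{A,B}(𝔽_p) contains a subgroup isomorphic to ℤ/2ℤ × ℤ/4ℤ, i.e., there is an injective group homomorphism ℤ/2ℤ × ℤ/4ℤ → W_{A,B}(𝔽_p). -/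
open WeierstrassCurve

/-- An element `T` of order two and an element `Q` of order four with `T ≠ 2Q` generate a copy of
`ℤ/2ℤ × ℤ/4ℤ`. -/
theorem exists_injective_zmod_two_prod_zmod_four {G : Type*} [AddCommGroup G] {T Q : G}
    (hT : 2 • T = 0) (hT0 : T ≠ 0) (hQ : 4 • Q = 0) (hQ0 : 2 • Q ≠ 0) (hTQ : T ≠ 2 • Q) :
    ∃ f : (ZMod 2 × ZMod 4) →+ G, Function.Injective f := by
  let fT : ZMod 2 →+ G := ZMod.lift 2 ⟨zmultiplesHom G T, by simpa [ofNat_zsmul] using hT⟩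
  let fQ : ZMod 4 →+ G := ZMod.lift 4 ⟨zmultiplesHom G Q, by simpa [ofNat_zsmul] using hQ⟩
  have fT_cast (n : ℤ) : fT n = n • T := by simp [fT]
  have fQ_cast (n : ℤ) : fQ n = n • Q := by simp [fQ]
  refine ⟨fT.coprod fQ, (injective_iff_map_eq_zero _).2 ?_⟩
  rintro ⟨a, b⟩ h
  obtain ⟨m, rfl⟩ := ZMod.intCast_surjective a
  obtain ⟨n, rfl⟩ := ZMod.intCast_surjective b
  rw [AddMonoidHom.coprod_apply, fT_cast, fQ_cast] at h
  have hT' (k : ℤ) : (2 * k) • T = 0 := by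
    rw [mul_comm, mul_zsmul, ofNat_zsmul, hT, zsmul_zero]
  have hQ' (k : ℤ) : (4 * k) • Q = 0 := by
    rw [mul_comm, mul_zsmul, ofNat_zsmul, hQ, zsmul_zero]
  have hn_even : Even n := by
    by_contra hn
    obtain ⟨k, rfl⟩ := Int.not_even_iff_odd.1 hn
    refine hQ0 ?_
    have h2 : (2 * m) • T + (4 * k) • Q + (2 : ℤ) • Q = 0 := by
      have h' := congrArg ((2 : ℤ) • ·) h
      simp only [smul_zero] at h'
      rw [← h']
      module
    rwa [hT', hQ', zero_add, zero_add, ofNat_zsmul] at h2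
  obtain ⟨k, rfl⟩ := hn_even
  obtain ⟨i, rfl | rfl⟩ := Int.even_or_odd' m <;> obtain ⟨j, rfl | rfl⟩ := Int.even_or_odd' k
  · rw [Prod.mk_eq_zero, ZMod.intCast_zmod_eq_zero_iff_dvd, ZMod.intCast_zmod_eq_zero_iff_dvd]
    omega
  · rw [hT', show 2 * j + 1 + (2 * j + 1) = 4 * j + 2 by ring, add_zsmul, hQ', zero_add,
      zero_add, ofNat_zsmul] at h
    exact absurd h hQ0
  · rw [add_zsmul, hT', show 2 * j + 2 * j = 4 * j by ring, hQ', zero_add, add_zero,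
      one_zsmul] at h
    exact absurd h hT0
  · rw [add_zsmul, hT', show 2 * j + 1 + (2 * j + 1) = 4 * j + 2 by ring, add_zsmul, hQ',
      zero_add, zero_add, one_zsmul, ofNat_zsmul] at h
    refine absurd ?_ hTQ
    rw [eq_neg_of_add_eq_zero_left h, neg_eq_iff_add_eq_zero, ← add_nsmul, hQ]

/-- A Montgomery curve in Weierstrass form over a field of characteristic not two, with `(A+2)/B`
and `A² − 4` squares, has a subgroup isomorphic to `ℤ/2ℤ × ℤ/4ℤ` in its group of points. -/
theorem montgomery_exists_injective_zmod_two_prod_zmod_four {F : Type*} [Field F] [DecidableEq F]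
    (h2 : (2 : F) ≠ 0) {A B : F} (hAB : B * (A ^ 2 - 4) ≠ 0)
    (hsq1 : IsSquare ((A + 2) / B)) (hsq2 : IsSquare (A ^ 2 - 4)) :
    ∃ f : (ZMod 2 × ZMod 4) →+ (⟨0, A * B, 0, B ^ 2, 0⟩ : WeierstrassCurve F).toAffine.Point,
      Function.Injective f := by
  obtain ⟨hB, hA⟩ := mul_ne_zero_iff.1 hAB
  obtain ⟨c, hc⟩ := hsq1
  obtain ⟨s, hs⟩ := hsq2
  have hcB : A + 2 = B * c ^ 2 := by rw [div_eq_iff hB] at hc; linear_combination hc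
  have hA2 : A + 2 ≠ 0 := fun h => hA (by linear_combination (A - 2) * h)
  have hc0 : c ≠ 0 := by rintro rfl; exact hA2 (by simpa using hcB)
  have hs0 : s ≠ 0 := by rintro rfl; exact hA (by simpa using hs)
  obtain ⟨t, ht⟩ : ∃ t, 2 * t = -A + s := ⟨(-A + s) / 2, by field_simp⟩
  have htq : t ^ 2 + A * t + 1 = 0 := by
    have h4 : (2 * 2 : F) ≠ 0 := mul_ne_zero h2 h2
    refine (mul_eq_zero.1 (?_ : (2 * 2 : F) * _ = 0)).resolve_left h4
    linear_combination (2 * t + s + A) * ht - hs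
  have ht0 : t ≠ 0 := by rintro rfl; simp at htq
  have hY0 : B ^ 2 * c ≠ 0 := mul_ne_zero (pow_ne_zero 2 hB) hc0
  set W : WeierstrassCurve F := ⟨0, A * B, 0, B ^ 2, 0⟩ with hW
  have hO : W.toAffine.Nonsingular 0 0 := by
    rw [Affine.nonsingular_iff, Affine.equation_iff]
    simp [hW, (pow_ne_zero 2 hB).symm]
  have hT : W.toAffine.Nonsingular (B * t) 0 := by
    rw [Affine.nonsingular_iff, Affine.equation_iff]
    refine ⟨by simp only [hW]; linear_combination (-B ^ 3 * t) * htq, Or.inl ?_⟩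
    have h : B ^ 2 * (t * s) ≠ 0 := mul_ne_zero (pow_ne_zero 2 hB) (mul_ne_zero ht0 hs0)
    refine fun h' => h ?_
    simp only [hW] at h'
    linear_combination -h' - B ^ 2 * htq - B ^ 2 * t * ht
  have hQ : W.toAffine.Nonsingular B (B ^ 2 * c) := by
    rw [Affine.nonsingular_iff, Affine.equation_iff]
    refine ⟨by simp only [hW]; linear_combination (-B ^ 3) * hcB, Or.inr ?_⟩
    refine fun h' => mul_ne_zero h2 hY0 ?_
    simp only [hW] at h'
    linear_combination h'
  have hQY : B ^ 2 * c ≠ W.toAffine.negY B (B ^ 2 * c) := by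
    refine fun h' => mul_ne_zero h2 hY0 ?_
    simp only [Affine.negY, hW] at h'
    linear_combination h'
  have hslope : W.toAffine.slope B B (B ^ 2 * c) (B ^ 2 * c) = B * c := by
    rw [Affine.slope_of_Y_ne rfl hQY, div_eq_iff (sub_ne_zero.2 hQY)]
    simp only [Affine.negY, hW]
    linear_combination 2 * B ^ 2 * hcB
  have hTT : 2 • Affine.Point.some _ _ hT = 0 := by
    rw [two_nsmul, Affine.Point.add_self_of_Y_eq]
    simp [Affine.negY, hW]
  have hOO : 2 • Affine.Point.some _ _ hO = 0 := by
    rw [two_nsmul, Affine.Point.add_self_of_Y_eq]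
    simp [Affine.negY, hW]
  have hQQ : 2 • Affine.Point.some _ _ hQ = Affine.Point.some _ _ hO := by
    rw [two_nsmul, Affine.Point.add_self_of_Y_ne hQY, Affine.Point.some.injEq, hslope]
    have hX : W.toAffine.addX B B (B * c) = 0 := by
      simp only [Affine.addX, hW]
      linear_combination -B * hcB
    refine ⟨hX, ?_⟩
    rw [Affine.addY, Affine.negAddY, hX]
    simp only [Affine.negY, hW]
    ring
  refine exists_injective_zmod_two_prod_zmod_four hTT (Affine.Point.some_ne_zero _)
    (Q := Affine.Point.some _ _ hQ) ?_ ?_ ?_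
  · rw [show 4 = 2 * 2 from rfl, mul_nsmul, hQQ, hOO]
  · rw [hQQ]
    exact Affine.Point.some_ne_zero _
  · rw [hQQ, ne_eq, Affine.Point.some.injEq]
    exact fun h => mul_ne_zero hB ht0 h.1

/-- For a prime `p > 3` with `p ≡ 1 (mod 4)`, a Montgomery curve
(in Weierstrass form `Y² = X³ + (AB)X² + B²X`) with `(A+2)/B` and `A² − 4` squares mod `p`
has a subgroup isomorphic to `ℤ/2ℤ × ℤ/4ℤ` in its group of points. -/
theorem montgomery_contains_Z2xZ4_of_one_mod_four
    (p : ℕ) [Fact (Nat.Prime p)] (hp : 3 < p) (A B : ZMod p)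
    (hAB : B * (A ^ 2 - 4) ≠ 0) (hp4 : p % 4 = 1)
    (hsq1 : IsSquare ((A + 2) / B)) (hsq2 : IsSquare (A ^ 2 - 4))
    (W : WeierstrassCurve (ZMod p)) (hW : W = ⟨0, A * B, 0, B ^ 2, 0⟩) :
    ∃ f : (ZMod 2 × ZMod 4) →+ W.toAffine.Point, Function.Injective f := by
  subst hW
  refine montgomery_exists_injective_zmod_two_prod_zmod_four (fun h => ?_) hAB hsq1 hsq2
  rw [← Nat.cast_ofNat, ZMod.natCast_eq_zero_iff] at h
  exact absurd (Nat.le_of_dvd two_pos h) (by omega)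
end

section
/- Let p > 3 be a prime and let A, B ∈ 𝔽_p satisfy B(A² − 4) ≠ 0. Let W_{A,B} be the elliptic curve Y² = X³ + (AB)X² + B²X over 𝔽_p. If p ≡ 1 (mod 4), A² − 4 is not a square in 𝔽_p, and B is a square in 𝔽_p, then the 8-torsion subgroup {P ∈ W_{A,B}(𝔽_p) : 8•P = O} is isomorphic as an abelian group to ℤ/8ℤ. -/
open WeierstrassCurve

/-- An abelian group with an element `Q` of order `8` whose only `2`-torsion elements are `0` and
`4 • Q` has `8`-torsion subgroup cyclic of order `8`. -/
lemma nonempty_torsionSubgroup_eight_addEquiv {G : Type*} [AddCommGroup G] {Q : G}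
    (hQ : addOrderOf Q = 8) (h2 : ∀ P : G, 2 • P = 0 → P = 0 ∨ P = 4 • Q) :
    Nonempty (torsionSubgroup G 8 ≃+ ZMod 8) := by
  have hQ8 : 8 • Q = 0 := hQ ▸ addOrderOf_nsmul_eq_zero Q
  have hmem (k : ℕ) : k • Q ∈ AddSubgroup.zmultiples Q :=
    AddSubgroup.nsmul_mem _ (AddSubgroup.mem_zmultiples Q) k
  have mem_of_two {P : G} (hP : 2 • P = 0) : P ∈ AddSubgroup.zmultiples Q := by
    rcases h2 P hP with rfl | rfl
    exacts [zero_mem _, hmem 4]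
  have mem_of_four {P : G} (hP : 4 • P = 0) : P ∈ AddSubgroup.zmultiples Q := by
    rcases h2 (2 • P) (by rw [← hP]; module) with h | h
    · exact mem_of_two h
    · rw [← sub_add_cancel P (2 • Q)]
      exact add_mem (mem_of_two (by rw [smul_sub, h]; module)) (hmem 2)
  have mem_of_eight {P : G} (hP : 8 • P = 0) : P ∈ AddSubgroup.zmultiples Q := by
    rcases h2 (4 • P) (by rw [← hP]; module) with h | h
    · exact mem_of_four h
    · rw [← sub_add_cancel P Q]
      exact add_mem (mem_of_four (by rw [smul_sub, h, sub_self])) (AddSubgroup.mem_zmultiples Q)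
  have heq : torsionSubgroup G 8 = AddSubgroup.zmultiples Q :=
    le_antisymm (fun _ => mem_of_eight) (AddSubgroup.zmultiples_le_of_mem hQ8)
  rw [heq]
  have card : Nat.card (AddSubgroup.zmultiples Q) = 8 := by rw [Nat.card_zmultiples, hQ]
  exact ⟨(card ▸ zmodAddCyclicAddEquiv (G := AddSubgroup.zmultiples Q) inferInstance).symm⟩

/-- In a finite field, the product of two non-squares is a square. -/
lemma FiniteField.isSquare_mul_of_not_isSquare {F : Type*} [Field F] [Finite F] {a b : F}
    (ha : ¬ IsSquare a) (hb : ¬ IsSquare b) : IsSquare (a * b) := by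
  classical
  have := Fintype.ofFinite F
  have hab : a * b ≠ 0 := mul_ne_zero (by rintro rfl; simp at ha) (by rintro rfl; simp at hb)
  rw [← quadraticChar_one_iff_isSquare hab, map_mul,
    quadraticChar_neg_one_iff_not_isSquare.mpr ha, quadraticChar_neg_one_iff_not_isSquare.mpr hb]
  norm_num

section Montgomery

variable {F : Type*} [Field F] [DecidableEq F] {W : WeierstrassCurve F}

/-- The `x`-coordinate of the double of a point on `Y² = X³ + aX² + dX`. -/
lemma exists_two_nsmul_eq_some (h2 : (2 : F) ≠ 0) {a d : F} (hW : W = ⟨0, a, 0, d, 0⟩)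
    {x y x' : F} (h : W.toAffine.Nonsingular x y) (hy : y ≠ 0)
    (hx' : x' * (2 * y) ^ 2 = (x ^ 2 - d) ^ 2) :
    ∃ (y' : F) (h' : W.toAffine.Nonsingular x' y'),
      2 • Affine.Point.some x y h = .some x' y' h' := by
  subst hW
  have heq := (Affine.equation_iff x y).mp h.1
  have hyn : y ≠ Affine.negY (⟨0, a, 0, d, 0⟩ : WeierstrassCurve F) x y := by
    intro e
    simp only [Affine.negY] at e
    exact mul_ne_zero h2 hy (by linear_combination e)
  have key := Affine.Point.add_self_of_Y_ne (h₁ := h) hyn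
  have hX : Affine.addX (⟨0, a, 0, d, 0⟩ : WeierstrassCurve F) x x
      (Affine.slope ⟨0, a, 0, d, 0⟩ x x y y) = x' := by
    rw [Affine.slope_of_Y_ne rfl hyn, eq_div_of_mul_eq (pow_ne_zero 2 (mul_ne_zero h2 hy)) hx']
    simp only [Affine.addX, Affine.negY, zero_mul, sub_zero, add_zero, sub_neg_eq_add,
      ← two_mul] at heq ⊢
    field_simp
    linear_combination (-8 * x - 4 * a) * heq
  rw [two_nsmul, key]
  subst hX
  exact ⟨_, _, rfl⟩

/-- If `A² - 4` is not a square then `(0, 0)` is the only rational point of order `2`. -/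
lemma eq_zero_or_eq_some_zero_of_two_nsmul_eq_zero (h2 : (2 : F) ≠ 0) {A B : F} (hB : B ≠ 0)
    (hns : ¬ IsSquare (A ^ 2 - 4)) (hW : W = ⟨0, A * B, 0, B ^ 2, 0⟩)
    (h0 : W.toAffine.Nonsingular 0 0) (P : W.toAffine.Point) (hP : 2 • P = 0) :
    P = 0 ∨ P = .some 0 0 h0 := by
  subst hW
  rcases P with _ | ⟨x, y, h⟩
  · exact .inl rfl
  right
  have heq := (Affine.equation_iff x y).mp h.1
  have hy : y = 0 := by
    by_contra hy
    obtain ⟨y', h', e⟩ := exists_two_nsmul_eq_some h2 rfl h hy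
      (div_mul_cancel₀ _ (pow_ne_zero 2 (mul_ne_zero h2 hy)))
    exact Affine.Point.some_ne_zero h' (e ▸ hP)
  subst hy
  have hx : x = 0 := by
    by_contra hx
    have hq : x ^ 2 + A * B * x + B ^ 2 = 0 := by
      refine (mul_eq_zero.mp ?_).resolve_left hx
      simp only at heq
      linear_combination -heq
    refine hns ⟨(2 * x + A * B) / B, ?_⟩
    field_simp
    linear_combination -4 * hq
  subst hx
  rfl

/-- If `s² = A + 2`, `s (s + 2)` is a square and `B = b²`, then the curve
`Y² = X³ + ABX² + B²X` has a point `Q` with `4 • Q = (0, 0)`. -/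
lemma exists_four_nsmul_eq_some_zero (h2 : (2 : F) ≠ 0) {A b s r : F} (hb : b ≠ 0)
    (hA : A ^ 2 - 4 ≠ 0) (hs : s ^ 2 = A + 2) (hr : r ^ 2 = s * (s + 2))
    (hW : W = ⟨0, A * b ^ 2, 0, (b ^ 2) ^ 2, 0⟩) (h0 : W.toAffine.Nonsingular 0 0) :
    ∃ Q : W.toAffine.Point, 4 • Q = .some 0 0 h0 := by
  have hΔ : W.Δ ≠ 0 := by
    have : W.Δ = 2 ^ 4 * b ^ 12 * (A ^ 2 - 4) := by
      subst hW
      simp only [WeierstrassCurve.Δ, WeierstrassCurve.b₂, WeierstrassCurve.b₄,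
        WeierstrassCurve.b₆, WeierstrassCurve.b₈]
      ring
    rw [this]
    exact mul_ne_zero (mul_ne_zero (pow_ne_zero _ h2) (pow_ne_zero _ hb)) hA
  obtain ⟨x, hx⟩ : ∃ x, x = 1 + s + r := ⟨_, rfl⟩
  have hxq : x ^ 2 - 2 * (1 + s) * x + 1 = 0 := by
    rw [hx]; linear_combination hr
  have hquart : (x ^ 2 - 1) ^ 2 = 4 * (x ^ 3 + A * x ^ 2 + x) := by
    linear_combination (x ^ 2 - 2 * (1 - s) * x + 1) * hxq + 4 * x ^ 2 * hs
  have hx1 : x ^ 2 - 1 ≠ 0 := by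
    intro h
    have hx0 : x ≠ 0 := by rintro rfl; simp at h
    have h4 : 4 * x ^ 2 * (2 * x + A * x ^ 2) = 0 := by
      linear_combination (x ^ 2 - 1) * x ^ 2 * h - x ^ 2 * hquart - 4 * x ^ 3 * h
    have h4' : (4 : F) ≠ 0 := by
      rw [show (4 : F) = 2 * 2 by norm_num]; exact mul_ne_zero h2 h2
    have h5 : 2 + A * x = 0 := by
      have : (4 * x ^ 3) * (2 + A * x) = 0 := by linear_combination h4
      exact (mul_eq_zero.mp this).resolve_left (mul_ne_zero h4' (pow_ne_zero 3 hx0))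
    exact hA (by linear_combination (A * x - 2) * h5 - A ^ 2 * h)
  obtain ⟨y, hy⟩ : ∃ y, y = b ^ 3 * (x ^ 2 - 1) / 2 := ⟨_, rfl⟩
  have hy' : 2 * y = b ^ 3 * (x ^ 2 - 1) := by rw [hy]; field_simp
  have hQ : W.toAffine.Nonsingular (b ^ 2 * x) y := by
    rw [← Affine.equation_iff_nonsingular_of_Δ_ne_zero hΔ, Affine.equation_iff]
    subst hW hy
    field_simp
    linear_combination b ^ 6 * hquart
  have hy0 : y ≠ 0 := by
    intro h
    rw [h, mul_zero] at hy'
    exact mul_ne_zero (pow_ne_zero 3 hb) hx1 hy'.symm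
  obtain ⟨y₂, hQ₂, e₂⟩ := exists_two_nsmul_eq_some h2 hW (x' := b ^ 2) hQ hy0 (by rw [hy']; ring)
  have heq₂ : y₂ ^ 2 = b ^ 6 * (A + 2) := by
    have := (Affine.equation_iff _ _).mp hQ₂.1
    subst hW
    simp only at this
    linear_combination this
  have hy₂ : y₂ ≠ 0 := by
    rintro rfl
    have : A + 2 = 0 := by simpa [hb] using heq₂.symm
    exact hA (by linear_combination (A - 2) * this)
  obtain ⟨y₄, hQ₄, e₄⟩ := exists_two_nsmul_eq_some h2 hW (x' := 0) hQ₂ hy₂ (by ring)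
  have hy₄ : y₄ = 0 := by
    have := (Affine.equation_iff _ _).mp hQ₄.1
    subst hW
    simpa using this
  subst hy₄
  exact ⟨_, by rw [show 4 = 2 * 2 by norm_num, mul_smul, e₂, e₄]⟩

end Montgomery

/-- The `8`-torsion over a finite field of odd characteristic, when `A + 2` is a square. -/
lemma nonempty_torsionSubgroup_eight_addEquiv_of_isSquare_add_two {F : Type*} [Field F] [Finite F]
    [DecidableEq F] {W : WeierstrassCurve F} (h2 : (2 : F) ≠ 0) {A B : F} (hB : B ≠ 0)
    (hns : ¬ IsSquare (A ^ 2 - 4)) (hsq : IsSquare B) (hA2 : IsSquare (A + 2))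
    (hW : W = ⟨0, A * B, 0, B ^ 2, 0⟩) :
    Nonempty (torsionSubgroup W.toAffine.Point 8 ≃+ ZMod 8) := by
  have hA : A ^ 2 - 4 ≠ 0 := fun h => hns (h ▸ IsSquare.zero)
  have h0 : W.toAffine.Nonsingular 0 0 := by
    subst hW
    simp [Affine.nonsingular_zero, hB]
  obtain ⟨b, hb⟩ := hsq
  rw [← sq] at hb
  have hb0 : b ≠ 0 := by rintro rfl; simp at hb; exact hB hb
  have hroot : ∃ s r : F, s ^ 2 = A + 2 ∧ r ^ 2 = s * (s + 2) := by
    obtain ⟨s, hs⟩ := hA2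
    by_cases h₁ : IsSquare (s * (s + 2))
    · obtain ⟨r, hr⟩ := h₁
      exact ⟨s, r, by rw [hs, sq], by rw [hr, sq]⟩
    by_cases h₂ : IsSquare (s * (s - 2))
    · obtain ⟨r, hr⟩ := h₂
      exact ⟨-s, r, by rw [hs]; ring, by linear_combination -hr⟩
    obtain ⟨t, ht⟩ := FiniteField.isSquare_mul_of_not_isSquare h₁ h₂
    refine absurd ⟨t, ?_⟩ hns
    linear_combination ht + (A - 2 + s ^ 2) * hs
  obtain ⟨s, r, hs, hr⟩ := hroot
  obtain ⟨Q, hQ⟩ := exists_four_nsmul_eq_some_zero h2 hb0 hA hs hr (by rw [hW, hb]) h0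
  refine nonempty_torsionSubgroup_eight_addEquiv (Q := Q) ?_ ?_
  · refine addOrderOf_eq_prime_pow (p := 2) (n := 2) ?_ ?_
    · rw [show 2 ^ 2 = 4 by norm_num, hQ]
      exact Affine.Point.some_ne_zero h0
    · rw [show 2 ^ (2 + 1) = 2 * 4 by norm_num, mul_smul, hQ, two_nsmul]
      exact Affine.Point.add_self_of_Y_eq (by subst hW; simp [Affine.negY])
  · rw [hQ]
    exact eq_zero_or_eq_some_zero_of_two_nsmul_eq_zero h2 hB hns hW h0

/-- For a prime `p > 3` with `p ≡ 1 (mod 4)`, a Montgomery curve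
(in Weierstrass form `Y² = X³ + (AB)X² + B²X`) with `A² − 4` a non-square and `B` a square
mod `p` has `8`-torsion subgroup isomorphic to `ℤ/8ℤ`. -/
theorem montgomery_eight_torsion_cyclic
    (p : ℕ) [Fact (Nat.Prime p)] (hp : 3 < p) (A B : ZMod p)
    (hAB : B * (A ^ 2 - 4) ≠ 0) (hp4 : p % 4 = 1)
    (hns : ¬ IsSquare (A ^ 2 - 4)) (hsq : IsSquare B)
    (W : WeierstrassCurve (ZMod p)) (hW : W = ⟨0, A * B, 0, B ^ 2, 0⟩) :
    Nonempty ((torsionSubgroup W.toAffine.Point 8) ≃+ ZMod 8) := by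
  have h2 : (2 : ZMod p) ≠ 0 := by
    rw [Ne, ← Nat.cast_two, ZMod.natCast_eq_zero_iff]
    exact fun h => absurd (Nat.le_of_dvd two_pos h) (by omega)
  have hB : B ≠ 0 := left_ne_zero_of_mul hAB
  by_cases hA : IsSquare (A + 2)
  · exact nonempty_torsionSubgroup_eight_addEquiv_of_isSquare_add_two h2 hB hns hsq hA hW
  have hneg : IsSquare (-1 : ZMod p) := ZMod.exists_sq_eq_neg_one_iff.mpr (by omega)
  have hA' : IsSquare (-A + 2) := by
    by_contra h
    apply hns
    rw [show A ^ 2 - 4 = -1 * ((A + 2) * (-A + 2)) by ring]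
    exact hneg.mul (FiniteField.isSquare_mul_of_not_isSquare hA h)
  refine nonempty_torsionSubgroup_eight_addEquiv_of_isSquare_add_two (A := -A) (B := -B) h2
    (neg_ne_zero.mpr hB) (by rwa [neg_sq]) ?_ hA' (by rw [hW, neg_mul_neg, neg_sq])
  simpa using hneg.mul hsq
end

section
/- Let p > 3 be a prime, let g ∈ 𝔽_p with g(g−1)(g+1) ≠ 0, set e = (g − g⁻¹)/2 and d = −e⁴, and assume e⁴ ≠ 1. Let t ∈ {1, −1} be such that t·g(g−1)(g+1) is a square in 𝔽_p. Then for each w ∈ {1, −1}: the element 4t·g^{2−w} / ((g−tw)³(g+tw)) is a square in 𝔽_p, and for every y ∈ 𝔽_p with y² = 4t·g^{2−w} / ((g−tw)³(g+tw)) and x = g^w·y, one has −x² + y² = 1 + d·x²·y² (so (x,y) lies on the twisted Edwards curve E_d), y² − x² ≠ 0, and there exists s ∈ {1, −1} such that 2xy·e = s·(y² − x²) and (x² + y²)·e = t·(2 − (y² − x²)); that is, under the Edwards doubling map (x,y) ↦ (2xy/(y²−x²), (x²+y²)/(2−(y²−x²))), the point (x,y) doubles to the 4-torsion point (s·e⁻¹,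 t·e⁻¹), so (x,y) is a point of order eight of E_d(𝔽_p). -/
/-- On the twisted Edwards curve `E_d : −x² + y² = 1 + dx²y²` with
`d = −e⁴`, `e = (g − g⁻¹)/2`, if `t ∈ {1,−1}` is such that `t·g(g−1)(g+1)` is a square
modulo `p`, then for each `w ∈ {1,−1}` the element `4t·g^{2−w}/((g−tw)³(g+tw))` is a square,
and each point `(x, y)` with `y² = 4t·g^{2−w}/((g−tw)³(g+tw))` and `x = g^w·y` lies on `E_d`,
has `y² − x² ≠ 0`, and doubles (via the Edwards doubling formulas) to `(s·e⁻¹, t·e⁻¹)` for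
some `s ∈ {1,−1}`. -/
theorem edwards_eight_torsion_points
    (p : ℕ) [Fact (Nat.Prime p)] (hp : 3 < p) (g : ZMod p)
    (hg : g * (g - 1) * (g + 1) ≠ 0)
    (e d : ZMod p) (he : e = (g - g⁻¹) / 2) (hd : d = -e ^ 4) (he4 : e ^ 4 ≠ 1)
    (t : ZMod p) (ht : t = 1 ∨ t = -1)
    (htsq : IsSquare (t * (g * (g - 1) * (g + 1))))
    (w : ℤ) (hw : w = 1 ∨ w = -1) :
    IsSquare (4 * t * g ^ (2 - w) / ((g - t * (w : ZMod p)) ^ 3 * (g + t * (w : ZMod p)))) ∧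
    ∀ x y : ZMod p,
      y ^ 2 = 4 * t * g ^ (2 - w) / ((g - t * (w : ZMod p)) ^ 3 * (g + t * (w : ZMod p))) →
      x = g ^ w * y →
      (-x ^ 2 + y ^ 2 = 1 + d * x ^ 2 * y ^ 2 ∧
       y ^ 2 - x ^ 2 ≠ 0 ∧
       ∃ s : ZMod p, (s = 1 ∨ s = -1) ∧
         2 * x * y * e = s * (y ^ 2 - x ^ 2) ∧
         (x ^ 2 + y ^ 2) * e = t * (2 - (y ^ 2 - x ^ 2))) := by
  have hg0 : g ≠ 0 := by rintro rfl; simp at hg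
  have hm : g - 1 ≠ 0 := by intro h; simp [h] at hg
  have hp1 : g + 1 ≠ 0 := by intro h; simp [h] at hg
  have h2 : (2 : ZMod p) ≠ 0 := by
    have : ((2 : ℕ) : ZMod p) ≠ 0 := by
      rw [Ne, ZMod.natCast_eq_zero_iff]
      exact fun h => absurd (Nat.le_of_dvd (by norm_num) h) (by omega)
    exact_mod_cast this
  have h4 : (4 : ZMod p) ≠ 0 := by
    have : (4 : ZMod p) = 2 * 2 := by norm_num
    rw [this]; exact mul_ne_zero h2 h2
  have ht2 : t ^ 2 = 1 := by rcases ht with rfl | rfl <;> norm_num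
  have ht0 : t ≠ 0 := by rintro rfl; norm_num at ht2
  have hmt : g - t ≠ 0 := by rcases ht with rfl | rfl <;> simpa [sub_neg_eq_add] using ‹_›
  have hpt : g + t ≠ 0 := by rcases ht with rfl | rfl <;> simpa [← sub_eq_add_neg] using ‹_›
  have he_mul : e * (2 * g) = (g - t) * (g + t) := by
    rw [he]; field_simp; linear_combination ht2
  obtain ⟨r, hr⟩ := htsq
  have hr_t : t * g * ((g - t) * (g + t)) = r * r := by
    linear_combination hr - t * g * ht2
  have he_div : e = (g - t) * (g + t) / (2 * g) := by field_simp; linear_combination he_mul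
  rcases hw with rfl | rfl
  · have e1 : g ^ ((2 : ℤ) - 1) = g := by norm_num
    simp only [e1, Int.cast_one, mul_one, zpow_one]
    refine ⟨⟨2 * r / ((g - t) ^ 2 * (g + t)), ?_⟩, ?_⟩
    · field_simp
      linear_combination 4 * hr_t
    rintro x y hy rfl
    have h_diff : y ^ 2 - (g * y) ^ 2 = -4 * t * g / (g - t) ^ 2 := by
      rw [mul_pow, hy]; field_simp; linear_combination -ht2
    refine ⟨?_, ?_, -1, Or.inr rfl, ?_, ?_⟩
    · have hq : d * (g * y) ^ 2 * y ^ 2 = -t ^ 2 * (g + t) ^ 2 / (g - t) ^ 2 := by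
        rw [mul_pow, hy, hd, he_div]; field_simp; ring
      rw [hq, neg_add_eq_sub, h_diff]
      field_simp
      linear_combination (g + t) ^ 2 * ht2
    · rw [h_diff]; simp [*]
    · linear_combination y ^ 2 * he_mul - y ^ 2 * ht2
    · rw [h_diff, he_div, mul_pow, hy]
      field_simp
      linear_combination -4 * ht2
  · have e1 : g ^ ((2 : ℤ) - -1) = g ^ 3 := by
      rw [sub_neg_eq_add]; norm_num
    rw [e1]
    simp only [Int.cast_neg, Int.cast_one, mul_neg, mul_one, zpow_neg_one, sub_neg_eq_add,
      ← sub_eq_add_neg]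
    refine ⟨⟨2 * r * g / ((g + t) ^ 2 * (g - t)), ?_⟩, ?_⟩
    · field_simp
      linear_combination 4 * hr_t
    rintro x y hy rfl
    have h_diff : y ^ 2 - (g⁻¹ * y) ^ 2 = 4 * t * g / (g + t) ^ 2 := by
      rw [mul_pow, hy]; field_simp; linear_combination ht2
    refine ⟨?_, ?_, 1, Or.inl rfl, ?_, ?_⟩
    · have hq : d * (g⁻¹ * y) ^ 2 * y ^ 2 = -t ^ 2 * (g - t) ^ 2 / (g + t) ^ 2 := by
        rw [mul_pow, hy, hd, he_div]; field_simp; ring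
      rw [hq, neg_add_eq_sub, h_diff]
      field_simp
      linear_combination (g - t) ^ 2 * ht2
    · rw [h_diff]; simp [*]
    · field_simp; linear_combination y ^ 2 * he_mul - y ^ 2 * ht2
    · rw [h_diff, he_div, mul_pow, hy]
      field_simp
      linear_combination -4 * ht2
end

section
/- Let p > 3 be a prime, let g ∈ 𝔽_p with g(g−1)(g+1) ≠ 0, set e = (g − g⁻¹)/2, and assume e⁴ ≠ 1. Let A = −2(e⁴+1)/(e⁴−1) and B = 4/(e⁴−1), and let W be the elliptic curve Y² = X³ + (AB)X² + B²X over 𝔽_p. Then 16 divides the order of the group W(𝔽_p). -/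
open WeierstrassCurve

/-- Two distinct elements of order two that are divisible by `2 ^ a` and `2 ^ b` respectively
contribute a factor of `2 ^ (a + 1) * 2 ^ (b + 1)` to the order of an abelian group. -/
theorem two_pow_mul_two_pow_dvd_card {G : Type*} [AddCommGroup G] {S T P Q : G} {a b : ℕ}
    (hS : S ≠ 0) (hT : T ≠ 0) (hST : S ≠ T) (hS2 : 2 • S = 0) (hT2 : 2 • T = 0)
    (hP : 2 ^ a • P = S) (hQ : 2 ^ b • Q = T) :
    2 ^ (a + 1) * 2 ^ (b + 1) ∣ Nat.card G := by
  have hordP : addOrderOf P = 2 ^ (a + 1) :=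
    addOrderOf_eq_prime_pow (by rwa [hP]) (by rw [pow_succ', mul_nsmul', hP, hS2])
  have hTP : T ∉ AddSubgroup.zmultiples P := by
    rintro ⟨k, hk⟩
    have h2k : ((2 * k : ℤ)) • P = 0 := by
      rw [mul_zsmul, show k • P = T from hk]
      exact_mod_cast hT2
    have hdvd := addOrderOf_dvd_iff_zsmul_eq_zero.2 h2k
    rw [hordP, pow_succ'] at hdvd
    push_cast at hdvd
    obtain ⟨j, rfl⟩ := (mul_dvd_mul_iff_left (two_ne_zero)).1 hdvd
    have hj : j • S = T := by
      rw [← hk, ← hP]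
      simp only [mul_comm _ j, mul_zsmul]
      norm_cast
    obtain ⟨m, rfl | rfl⟩ := Int.even_or_odd' j
    · apply hT
      rw [← hj, mul_comm, mul_zsmul, show (2 : ℤ) • S = 0 by exact_mod_cast hS2, smul_zero]
    · apply hST
      rw [← hj, add_zsmul, mul_comm, mul_zsmul,
        show (2 : ℤ) • S = 0 by exact_mod_cast hS2, smul_zero, zero_add, one_zsmul]
  have hordQ : addOrderOf (Q : G ⧸ AddSubgroup.zmultiples P) = 2 ^ (b + 1) := by
    apply addOrderOf_eq_prime_pow
    · rw [← QuotientAddGroup.mk_nsmul, hQ, QuotientAddGroup.eq_zero_iff]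
      exact hTP
    · rw [pow_succ', mul_nsmul', ← QuotientAddGroup.mk_nsmul, hQ, ← QuotientAddGroup.mk_nsmul,
        hT2, QuotientAddGroup.mk_zero]
  rw [AddSubgroup.card_eq_card_quotient_mul_card_addSubgroup (AddSubgroup.zmultiples P),
    Nat.card_zmultiples, hordP, mul_comm]
  exact mul_dvd_mul_right (hordQ ▸ addOrderOf_dvd_natCard _) _

section Halving

variable {F : Type*} [Field F] [DecidableEq F]

/-- On `Y² = (X - c₁)(X - c₂)(X - c₃)` with `cᵢ = x - rᵢ²` pairwise distinct, the point
`(x, r₁r₂r₃)` is twice a rational point, given explicitly. -/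
theorem exists_two_nsmul_eq {W : WeierstrassCurve F} (h2 : (2 : F) ≠ 0) {x y r₁ r₂ r₃ : F}
    (h₁₂ : r₁ ^ 2 ≠ r₂ ^ 2) (h₁₃ : r₁ ^ 2 ≠ r₃ ^ 2) (h₂₃ : r₂ ^ 2 ≠ r₃ ^ 2)
    (ha₁ : W.a₁ = 0) (ha₂ : W.a₂ = -((x - r₁ ^ 2) + (x - r₂ ^ 2) + (x - r₃ ^ 2)))
    (ha₃ : W.a₃ = 0)
    (ha₄ : W.a₄ = (x - r₁ ^ 2) * (x - r₂ ^ 2) + (x - r₁ ^ 2) * (x - r₃ ^ 2) +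
      (x - r₂ ^ 2) * (x - r₃ ^ 2))
    (ha₆ : W.a₆ = -((x - r₁ ^ 2) * (x - r₂ ^ 2) * (x - r₃ ^ 2)))
    (hy' : r₁ * r₂ * r₃ = y) (h : W.toAffine.Nonsingular x y) :
    ∃ h' : W.toAffine.Nonsingular (x + r₁ * r₂ + r₁ * r₃ + r₂ * r₃)
        ((r₁ + r₂) * (r₁ + r₃) * (r₂ + r₃)),
      2 • Affine.Point.some _ _ h' = Affine.Point.some _ _ h := by
  have s₁₂ : r₁ + r₂ ≠ 0 := fun hr ↦ h₁₂ (by linear_combination (r₁ - r₂) * hr)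
  have s₁₃ : r₁ + r₃ ≠ 0 := fun hr ↦ h₁₃ (by linear_combination (r₁ - r₃) * hr)
  have s₂₃ : r₂ + r₃ ≠ 0 := fun hr ↦ h₂₃ (by linear_combination (r₂ - r₃) * hr)
  have hy0 : (r₁ + r₂) * (r₁ + r₃) * (r₂ + r₃) ≠ 0 := by positivity
  have hy : (r₁ + r₂) * (r₁ + r₃) * (r₂ + r₃) ≠
      W.toAffine.negY (x + r₁ * r₂ + r₁ * r₃ + r₂ * r₃)
        ((r₁ + r₂) * (r₁ + r₃) * (r₂ + r₃)) := by
    intro hy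
    rw [Affine.negY, ha₁, ha₃] at hy
    exact mul_ne_zero h2 hy0 (by linear_combination hy)
  have hns : W.toAffine.Nonsingular (x + r₁ * r₂ + r₁ * r₃ + r₂ * r₃)
      ((r₁ + r₂) * (r₁ + r₃) * (r₂ + r₃)) := by
    rw [Affine.nonsingular_iff]
    refine ⟨?_, Or.inr hy⟩
    rw [Affine.equation_iff, ha₁, ha₂, ha₃, ha₄, ha₆]
    ring
  refine ⟨hns, ?_⟩
  have hslope : W.toAffine.slope (x + r₁ * r₂ + r₁ * r₃ + r₂ * r₃)
      (x + r₁ * r₂ + r₁ * r₃ + r₂ * r₃) ((r₁ + r₂) * (r₁ + r₃) * (r₂ + r₃))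
      ((r₁ + r₂) * (r₁ + r₃) * (r₂ + r₃)) = r₁ + r₂ + r₃ := by
    rw [Affine.slope_of_Y_ne rfl hy, div_eq_iff (sub_ne_zero.2 hy), Affine.negY,
      ha₁, ha₂, ha₃, ha₄]
    ring
  rw [two_nsmul, Affine.Point.add_self_of_Y_ne hy, Affine.Point.some.injEq, hslope]
  constructor
  · rw [Affine.addX, ha₁, ha₂]
    ring
  · rw [← hy', Affine.addY, Affine.negAddY, Affine.negY, Affine.addX, ha₁, ha₂, ha₃]
    ring

/-- If `c = a² - b²` is a square, then `Y² = X(X - a²)(X - b²)` has order divisible by `16`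
as soon as `-1` is a square, or `a(a + c)`, `ac` and `c(a + c)` are. -/
theorem sixteen_dvd_card_of_sq_sub_sq_eq_sq {a b c : F} (h2 : (2 : F) ≠ 0) (ha : a ≠ 0)
    (hb : b ≠ 0) (hc : c ≠ 0) (habc : a ^ 2 - b ^ 2 = c ^ 2)
    (h : IsSquare (-1 : F) ∨ ∃ r s t, r ^ 2 = a * (a + c) ∧ s ^ 2 = a * c ∧
      t ^ 2 = c * (a + c) ∧ r * s * t = a * c * (a + c)) {W : WeierstrassCurve F}
    (hW : W = ⟨0, -(a ^ 2 + b ^ 2), 0, a ^ 2 * b ^ 2, 0⟩) :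
    16 ∣ Nat.card W.toAffine.Point := by
  have ha2 := pow_ne_zero 2 ha
  have hb2 := pow_ne_zero 2 hb
  have hc2 := pow_ne_zero 2 hc
  have hab : a ^ 2 ≠ b ^ 2 := fun hab ↦ hc2 (by rw [← habc, hab, sub_self])
  have hS : W.toAffine.Nonsingular (a ^ 2) 0 := by
    rw [Affine.nonsingular_iff, Affine.equation_iff]
    subst hW
    refine ⟨by ring, Or.inl fun hS ↦ mul_ne_zero ha2 hc2 ?_⟩
    linear_combination -hS - a ^ 2 * habc
  have hT : W.toAffine.Nonsingular 0 0 := by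
    rw [Affine.nonsingular_iff, Affine.equation_iff]
    subst hW
    refine ⟨by ring, Or.inl fun hT ↦ mul_ne_zero ha2 hb2 ?_⟩
    linear_combination -hT
  have hS0 : Affine.Point.some _ _ hS ≠ 0 := Affine.Point.some_ne_zero hS
  have hT0 : Affine.Point.some _ _ hT ≠ 0 := Affine.Point.some_ne_zero hT
  have hST : Affine.Point.some _ _ hS ≠ Affine.Point.some _ _ hT := by
    rw [Ne, Affine.Point.some.injEq]
    exact fun hST ↦ ha2 hST.1
  have hS2 : 2 • Affine.Point.some _ _ hS = 0 := by
    rw [two_nsmul]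
    exact Affine.Point.add_self_of_Y_eq (by simp [Affine.negY, hW])
  have hT2 : 2 • Affine.Point.some _ _ hT = 0 := by
    rw [two_nsmul]
    exact Affine.Point.add_self_of_Y_eq (by simp [Affine.negY, hW])
  obtain ⟨hP, hPS⟩ := exists_two_nsmul_eq (r₁ := a) (r₂ := 0) (r₃ := c) h2
    (by simpa using ha) (fun hac ↦ hb2 (by linear_combination hac - habc)) (by simpa using hc2.symm)
    (by rw [hW]) (by rw [hW]; linear_combination habc) (by rw [hW])
    (by rw [hW]; linear_combination -a ^ 2 * habc) (by rw [hW]; ring) (by ring) hS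
  obtain ⟨i, hi⟩ | ⟨r, s, t, hr, hs, ht, hrst⟩ := h
  · obtain ⟨hQ, hQT⟩ := exists_two_nsmul_eq (r₁ := 0) (r₂ := i * a) (r₃ := i * b) h2
      (fun hia ↦ ha2 (by linear_combination -a ^ 2 * hi + hia))
      (fun hib ↦ hb2 (by linear_combination -b ^ 2 * hi + hib))
      (fun hiab ↦ hab (by linear_combination (b ^ 2 - a ^ 2) * hi - hiab))
      (by rw [hW]) (by rw [hW]; linear_combination (a ^ 2 + b ^ 2) * hi) (by rw [hW])
      (by rw [hW]; linear_combination (a ^ 2 * b ^ 2 * (i ^ 2 - 1)) * hi) (by rw [hW]; ring)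
      (by ring) hT
    exact two_pow_mul_two_pow_dvd_card (a := 1) (b := 1) hS0 hT0 hST hS2 hT2 hPS hQT
  · obtain ⟨hR, hRP⟩ := exists_two_nsmul_eq (r₁ := r) (r₂ := s) (r₃ := t) h2
      (fun hrs ↦ ha2 (by linear_combination hrs - hr + hs))
      (fun hrt ↦ hb2 (by linear_combination hrt - hr + ht - habc))
      (fun hst ↦ hc2 (by linear_combination -hst + hs - ht))
      (by rw [hW]) (by rw [hW]; linear_combination habc - hr - hs - ht) (by rw [hW])
      (by rw [hW, hr, hs, ht]; linear_combination -a ^ 2 * habc)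
      (by rw [hW, hr]; ring)
      (by linear_combination hrst) hP
    refine two_pow_mul_two_pow_dvd_card (P := .some _ _ hR) (a := 2) (b := 0) hS0 hT0 hST hS2 hT2 ?_
      (one_nsmul _)
    rw [pow_two, mul_nsmul', hRP, hPS]

/-- If `e² + 1` is a square, then `Y² = X(X - a²)(X - b²)` with `a = 2(e² + 1)/(e⁴ - 1)` and
`b = 2(e² - 1)/(e⁴ - 1)` has order divisible by `16` as soon as `-1` or `2e` is a square. -/
theorem sixteen_dvd_card_of_isSquare {e : F} (h2 : (2 : F) ≠ 0) (he : e ≠ 0) (he4 : e ^ 4 ≠ 1)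
    (hsq : IsSquare (e ^ 2 + 1)) (h : IsSquare (-1 : F) ∨ IsSquare (2 * e))
    {W : WeierstrassCurve F}
    (hW : W = ⟨0, -8 * (e ^ 4 + 1) / (e ^ 4 - 1) ^ 2, 0, 16 / (e ^ 4 - 1) ^ 2, 0⟩) :
    16 ∣ Nat.card W.toAffine.Point := by
  have hD : e ^ 4 - 1 ≠ 0 := sub_ne_zero.2 he4
  have hD' : (e ^ 2 + 1) * (e ^ 2 - 1) ≠ 0 := by convert hD using 1; ring
  apply sixteen_dvd_card_of_sq_sub_sq_eq_sq (a := 2 * (e ^ 2 + 1) / (e ^ 4 - 1))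
    (b := 2 * (e ^ 2 - 1) / (e ^ 4 - 1)) (c := 4 * e / (e ^ 4 - 1)) h2
  · exact div_ne_zero (mul_ne_zero h2 (left_ne_zero_of_mul hD')) hD
  · exact div_ne_zero (mul_ne_zero h2 (right_ne_zero_of_mul hD')) hD
  · refine div_ne_zero (mul_ne_zero ?_ he) hD
    convert mul_ne_zero h2 h2 using 1
    norm_num
  · field_simp
    ring
  · refine h.imp id ?_
    rintro ⟨u, hu⟩
    obtain ⟨v, hv⟩ := hsq
    have hu4 : 4 * e = 2 * u ^ 2 := by linear_combination 2 * hu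
    have hv2 : e ^ 2 + 1 = v ^ 2 := by linear_combination hv
    have hac : 2 * (e ^ 2 + 1) / (e ^ 4 - 1) + 4 * e / (e ^ 4 - 1) =
        2 * (e + 1) ^ 2 / (e ^ 4 - 1) := by ring
    rw [hac, hu4, hv2]
    exact ⟨2 * v * (e + 1) / (e ^ 4 - 1), 2 * u * v / (e ^ 4 - 1), 2 * u * (e + 1) / (e ^ 4 - 1),
      by ring, by ring, by ring, by ring⟩
  · rw [hW]
    congr 1
    · field_simp
      ring
    · field_simp
      ring

end Halving

/-- For a prime `p > 3` and `g` with `g(g−1)(g+1) ≠ 0`, `e = (g − g⁻¹)/2`,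
`e⁴ ≠ 1`, the Weierstrass model `W : Y² = X³ + (AB)X² + B²X` of the twisted Edwards curve
`E_{−e⁴}` (with `A = −2(e⁴+1)/(e⁴−1)`, `B = 4/(e⁴−1)`) has group order divisible by `16`. -/
theorem sixteen_dvd_card_edwards_family
    (p : ℕ) [Fact (Nat.Prime p)] (hp : 3 < p) (g : ZMod p)
    (hg : g * (g - 1) * (g + 1) ≠ 0)
    (e : ZMod p) (he : e = (g - g⁻¹) / 2) (he4 : e ^ 4 ≠ 1)
    (A B : ZMod p) (hA : A = -2 * (e ^ 4 + 1) / (e ^ 4 - 1)) (hB : B = 4 / (e ^ 4 - 1))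
    (W : WeierstrassCurve (ZMod p)) (hW : W = ⟨0, A * B, 0, B ^ 2, 0⟩) :
    16 ∣ Nat.card W.toAffine.Point := by
  have h2 : (2 : ZMod p) ≠ 0 := by
    intro h
    have := Nat.le_of_dvd two_pos ((ZMod.natCast_eq_zero_iff 2 p).1 (by exact_mod_cast h))
    omega
  have hg0 : g ≠ 0 := left_ne_zero_of_mul (left_ne_zero_of_mul hg)
  have he0 : e ≠ 0 := by
    rintro rfl
    have hgg : g - g⁻¹ = 0 := (div_eq_zero_iff.1 he.symm).resolve_right h2
    apply hg
    linear_combination g ^ 2 * hgg + g * mul_inv_cancel₀ hg0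
  have hsq : IsSquare (e ^ 2 + 1) := ⟨(g + g⁻¹) / 2, by rw [he]; field_simp; ring⟩
  have hD : e ^ 4 - 1 ≠ 0 := sub_ne_zero.2 he4
  have hW' : W = ⟨0, -8 * (e ^ 4 + 1) / (e ^ 4 - 1) ^ 2, 0, 16 / (e ^ 4 - 1) ^ 2, 0⟩ := by
    rw [hW, hA, hB]
    congr 1
    · field_simp
      ring
    · field_simp
      ring
  by_cases h1 : IsSquare (-1 : ZMod p)
  · exact sixteen_dvd_card_of_isSquare h2 he0 he4 hsq (.inl h1) hW'
  by_cases h2e : IsSquare (2 * e)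
  · exact sixteen_dvd_card_of_isSquare h2 he0 he4 hsq (.inr h2e) hW'
  have h2e' : IsSquare (2 * -e) := by
    have hmul := map_mul (quadraticChar (ZMod p)) (-1) (2 * e)
    rw [quadraticChar_neg_one_iff_not_isSquare.2 h1,
      quadraticChar_neg_one_iff_not_isSquare.2 h2e] at hmul
    convert (quadraticChar_one_iff_isSquare ?_).1 (hmul.trans (by norm_num)) using 1
    · ring
    · exact mul_ne_zero (neg_ne_zero.2 one_ne_zero) (mul_ne_zero h2 he0)
  exact sixteen_dvd_card_of_isSquare (e := -e) h2 (neg_ne_zero.2 he0)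
    (by rwa [Even.neg_pow ⟨2, rfl⟩])
    (by rwa [neg_sq]) (.inr h2e') (by rwa [Even.neg_pow ⟨2, rfl⟩])
end

section
/- Let p be a prime with p ≡ 1 (mod 4), let g ∈ 𝔽_p with g(g−1)(g+1) ≠ 0, set e = (g − g⁻¹)/2, and assume e⁴ ≠ 1. Let A = −2(e⁴+1)/(e⁴−1) and B = 4/(e⁴−1), and let W be the elliptic curve Y² = X³ + (AB)X² + B²X over 𝔽_p. If g(g−1)(g+1) is a square in 𝔽_p, then 32 divides the order of the group W(𝔽_p). -/
open WeierstrassCurve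

/-- An additive commutative group containing an element `Q` of order `8` and an element `R` such
that `2R` is an involution different from `4Q` has order divisible by `32`. -/
theorem thirtytwo_dvd_card_of_four_nsmul_ne {G : Type*} [AddCommGroup G] (Q R : G)
    (hQ : 4 • Q ≠ 0) (hQ' : 8 • Q = 0) (hR : 2 • R ≠ 0) (hR' : 4 • R = 0)
    (hne : 2 • R ≠ 4 • Q) : 32 ∣ Nat.card G := by
  have hQo : addOrderOf Q = 2 ^ (2 + 1) :=
    addOrderOf_eq_prime_pow (by simpa using hQ) (by simpa using hQ')
  have hmem : 2 • R ∉ AddSubgroup.zmultiples Q := by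
    rintro ⟨n, hn⟩
    have hn : n • Q = 2 • R := hn
    have h0 : (2 * n) • Q = 0 := by
      rw [mul_smul, hn, ofNat_zsmul, ← mul_nsmul, hR']
    have hdvd : (8 : ℤ) ∣ 2 * n := by
      have := addOrderOf_dvd_iff_zsmul_eq_zero.mpr h0
      rw [hQo] at this
      exact_mod_cast this
    have hcases : (8 : ℤ) ∣ n ∨ (8 : ℤ) ∣ n - 4 := by lia
    have hQz : (8 : ℤ) • Q = 0 := by rw [ofNat_zsmul, hQ']
    rcases hcases with ⟨m, hm⟩ | ⟨m, hm⟩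
    · apply hR
      rw [← hn, hm, mul_comm, mul_smul, hQz, smul_zero]
    · apply hne
      rw [← hn, show n = m * 8 + 4 by lia, add_smul, mul_smul, hQz, smul_zero, zero_add,
        ofNat_zsmul]
  have hRo : addOrderOf (R : G ⧸ AddSubgroup.zmultiples Q) = 2 ^ (1 + 1) := by
    apply addOrderOf_eq_prime_pow
    · rw [pow_one, ← QuotientAddGroup.mk_nsmul, QuotientAddGroup.eq_zero_iff]
      exact hmem
    · rw [← QuotientAddGroup.mk_nsmul]
      simp [hR']
  have h4 := addOrderOf_dvd_natCard (R : G ⧸ AddSubgroup.zmultiples Q)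
  rw [hRo] at h4
  rw [AddSubgroup.card_eq_card_quotient_mul_card_addSubgroup (AddSubgroup.zmultiples Q),
    Nat.card_zmultiples, hQo]
  exact mul_dvd_mul h4 (dvd_refl 8)

/-- Halving on `Y² = X(X − u)(X − v)`: if `x`, `x − u`, `x − v` are the squares of `r`, `s`, `t`,
then `(x, rst)` is the double of an explicit point. -/
theorem exists_two_nsmul_eq_of_sq {F : Type*} [Field F] [DecidableEq F] (h2 : (2 : F) ≠ 0)
    {u v x r s t : F} (hu : u ≠ 0) (hv : v ≠ 0) (huv : u ≠ v)
    (hr : x = r ^ 2) (hs : x - u = s ^ 2) (ht : x - v = t ^ 2)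
    (W : WeierstrassCurve F) (hW : W = ⟨0, -(u + v), 0, u * v, 0⟩)
    (h : W.toAffine.Nonsingular x (r * s * t)) :
    ∃ h' : W.toAffine.Nonsingular (x + r * s + r * t + s * t) ((r + s) * (r + t) * (s + t)),
      2 • Affine.Point.some _ _ h' = Affine.Point.some _ _ h := by
  obtain rfl : u = r ^ 2 - s ^ 2 := by linear_combination -hs + hr
  obtain rfl : v = r ^ 2 - t ^ 2 := by linear_combination -ht + hr
  subst hr hW
  have hrs : r + s ≠ 0 := fun h ↦ hu (by linear_combination (r - s) * h)
  have hrt : r + t ≠ 0 := fun h ↦ hv (by linear_combination (r - t) * h)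
  have hst : s + t ≠ 0 := fun h ↦ huv (by linear_combination (t - s) * h)
  have hy : (r + s) * (r + t) * (s + t) ≠ 0 := mul_ne_zero (mul_ne_zero hrs hrt) hst
  have h2y : 2 * ((r + s) * (r + t) * (s + t)) ≠ 0 := mul_ne_zero h2 hy
  refine ⟨?_, ?_⟩
  · rw [Affine.nonsingular_iff, Affine.equation_iff]
    refine ⟨by simp only; ring, Or.inr ?_⟩
    simp only
    intro h
    exact h2y (by linear_combination h)
  · rw [two_nsmul, Affine.Point.add_self_of_Y_ne]
    · have hsl : Affine.slope (W := WeierstrassCurve.toAffine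
          ⟨0, -(r ^ 2 - s ^ 2 + (r ^ 2 - t ^ 2)), 0, (r ^ 2 - s ^ 2) * (r ^ 2 - t ^ 2), 0⟩)
          (r ^ 2 + r * s + r * t + s * t) (r ^ 2 + r * s + r * t + s * t)
          ((r + s) * (r + t) * (s + t)) ((r + s) * (r + t) * (s + t)) = r + s + t := by
        rw [Affine.slope_of_Y_ne rfl]
        · simp only [Affine.negY]
          rw [div_eq_iff]
          · ring
          · intro h
            exact h2y (by linear_combination h)
        · simp only [Affine.negY]
          intro h
          exact h2y (by linear_combination h)
      simp only [Affine.Point.some.injEq, hsl, Affine.addX, Affine.addY, Affine.negAddY,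
        Affine.negY]
      constructor <;> ring
    · simp only [Affine.negY]
      intro h
      exact h2y (by linear_combination h)

/-- Sufficient condition for `32` to divide the order of `Y² = X(X − a²)(X − b²)`: `-1` and
`a² − b² = c²` are squares, and the point `(a² + ac, ac(a + c))` of order `4` is halvable
because its abscissa minus each root is a square. -/
theorem thirtytwo_dvd_card_of_sq {F : Type*} [Field F] [DecidableEq F] (h2 : (2 : F) ≠ 0)
    {a b c i r s t : F} (ha : a ≠ 0) (hb : b ≠ 0) (hc : c ≠ 0) (hi : i ^ 2 = -1)
    (habc : a ^ 2 - b ^ 2 = c ^ 2) (hr : a ^ 2 + a * c = r ^ 2) (hs : a * c = s ^ 2)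
    (ht : a ^ 2 + a * c - b ^ 2 = t ^ 2) (hrst : r * s * t = a * c * (a + c))
    (W : WeierstrassCurve F) (hW : W = ⟨0, -(a ^ 2 + b ^ 2), 0, a ^ 2 * b ^ 2, 0⟩) :
    32 ∣ Nat.card W.toAffine.Point := by
  have hab : a ^ 2 ≠ b ^ 2 := fun h ↦ hc (by simpa [h] using habc.symm)
  have ha2 : a ^ 2 ≠ 0 := pow_ne_zero 2 ha
  have hb2 : b ^ 2 ≠ 0 := pow_ne_zero 2 hb
  have hc2 : c ^ 2 ≠ 0 := pow_ne_zero 2 hc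
  have n0 : W.toAffine.Nonsingular 0 (0 * (i * a) * (i * b)) := by
    subst hW
    rw [Affine.nonsingular_iff, Affine.equation_iff]
    refine ⟨by simp only; ring, Or.inl ?_⟩
    simp only
    intro h
    exact mul_ne_zero ha2 hb2 (by linear_combination -h)
  have n1 : W.toAffine.Nonsingular (a ^ 2) (a * 0 * c) := by
    subst hW
    rw [Affine.nonsingular_iff, Affine.equation_iff]
    refine ⟨by simp only; ring, Or.inl ?_⟩
    simp only
    intro h
    exact mul_ne_zero ha2 hc2 (by linear_combination -h - a ^ 2 * habc)
  obtain ⟨nR, hR⟩ := exists_two_nsmul_eq_of_sq h2 ha2 hb2 hab (by ring)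
    (by linear_combination -a ^ 2 * hi) (by linear_combination -b ^ 2 * hi) W hW n0
  obtain ⟨nP, hP⟩ := exists_two_nsmul_eq_of_sq h2 ha2 hb2 hab rfl (by ring) habc W hW n1
  have nP' : W.toAffine.Nonsingular (a ^ 2 + a * c) (r * s * t) := by
    convert nP using 1
    · ring
    · rw [hrst]; ring
  obtain ⟨nQ, hQ⟩ := exists_two_nsmul_eq_of_sq h2 ha2 hb2 hab hr
    (by linear_combination hs) ht W hW nP'
  have hPP : Affine.Point.some _ _ nP' = Affine.Point.some _ _ nP := by
    simp only [Affine.Point.some.injEq]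
    constructor
    · ring
    · rw [hrst]; ring
  have d0 : 2 • Affine.Point.some _ _ n0 = 0 := by
    rw [two_nsmul, Affine.Point.add_self_of_Y_eq]
    subst hW
    simp [Affine.negY]
  have d1 : 2 • Affine.Point.some _ _ n1 = 0 := by
    rw [two_nsmul, Affine.Point.add_self_of_Y_eq]
    subst hW
    simp [Affine.negY]
  have h4Q : 4 • Affine.Point.some _ _ nQ = Affine.Point.some _ _ n1 := by
    rw [show 4 = 2 * 2 from rfl, mul_nsmul, hQ, hPP, hP]
  refine thirtytwo_dvd_card_of_four_nsmul_ne (.some _ _ nQ) (.some _ _ nR) ?_ ?_ ?_ ?_ ?_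
  · rw [h4Q]
    exact Affine.Point.some_ne_zero _
  · rw [show 8 = 4 * 2 from rfl, mul_nsmul, h4Q, d1]
  · rw [hR]
    exact Affine.Point.some_ne_zero _
  · rw [show 4 = 2 * 2 from rfl, mul_nsmul, hR, d0]
  · rw [hR, h4Q]
    intro h
    exact ha2 ((Affine.Point.some.injEq ..).mp h).1.symm

/-- For a prime `p ≡ 1 (mod 4)` and `g` with `g(g−1)(g+1) ≠ 0` a square
modulo `p`, `e = (g − g⁻¹)/2`, `e⁴ ≠ 1`, the Weierstrass model `W : Y² = X³ + (AB)X² + B²X`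
of the twisted Edwards curve `E_{−e⁴}` (with `A = −2(e⁴+1)/(e⁴−1)`, `B = 4/(e⁴−1)`) has
group order divisible by `32`. -/
theorem thirtytwo_dvd_card_edwards_family
    (p : ℕ) [Fact (Nat.Prime p)] (hp4 : p % 4 = 1) (g : ZMod p)
    (hg : g * (g - 1) * (g + 1) ≠ 0)
    (e : ZMod p) (he : e = (g - g⁻¹) / 2) (he4 : e ^ 4 ≠ 1)
    (A B : ZMod p) (hA : A = -2 * (e ^ 4 + 1) / (e ^ 4 - 1)) (hB : B = 4 / (e ^ 4 - 1))
    (hsq : IsSquare (g * (g - 1) * (g + 1)))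
    (W : WeierstrassCurve (ZMod p)) (hW : W = ⟨0, A * B, 0, B ^ 2, 0⟩) :
    32 ∣ Nat.card W.toAffine.Point := by
  have hp2 : p ≠ 2 := by rintro rfl; omega
  have h2 : (2 : ZMod p) ≠ 0 := by
    exact Ring.two_ne_zero (by rwa [ZMod.ringChar_zmod_n])
  obtain ⟨i, hi⟩ := ZMod.exists_sq_eq_neg_one_iff.mpr (by omega : p % 4 ≠ 3)
  obtain ⟨k, hk⟩ := hsq
  have hg0 : g ≠ 0 := by rintro rfl; simp at hg
  have hg1 : g - 1 ≠ 0 := by intro h; simp [h] at hg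
  have hg2 : g + 1 ≠ 0 := by intro h; simp [h] at hg
  have heg : 2 * g * e = (g - 1) * (g + 1) := by rw [he]; field_simp; ring
  have he0 : e ≠ 0 := by
    rintro rfl
    exact mul_ne_zero hg1 hg2 (by linear_combination -heg)
  have hm : e ^ 2 - 1 ≠ 0 := fun h ↦ he4 (by linear_combination (e ^ 2 + 1) * h)
  have hp : e ^ 2 + 1 ≠ 0 := fun h ↦ he4 (by linear_combination (e ^ 2 - 1) * h)
  have hfac : e ^ 4 - 1 = (e ^ 2 - 1) * (e ^ 2 + 1) := by ring
  obtain ⟨h, hh⟩ : ∃ h, h ^ 2 = e ^ 2 + 1 :=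
    ⟨(g + g⁻¹) / 2, by rw [he]; field_simp; ring⟩
  have hh0 : h ≠ 0 := by rintro rfl; exact hp (by linear_combination -hh)
  obtain ⟨m, hm2⟩ : ∃ m, m ^ 2 = 2 * e := by
    refine ⟨k / g, ?_⟩
    field_simp
    linear_combination -hk - g * heg
  refine thirtytwo_dvd_card_of_sq (a := 2 / (e ^ 2 - 1)) (b := 2 / (e ^ 2 + 1))
    (c := 4 * e / ((e ^ 2 - 1) * (e ^ 2 + 1))) (i := i)
    (r := 2 * (e + 1) / ((e ^ 2 - 1) * h)) (s := 2 * m / ((e ^ 2 - 1) * h))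
    (t := 2 * m * (e + 1) / ((e ^ 2 - 1) * (e ^ 2 + 1)))
    h2 (div_ne_zero h2 hm) (div_ne_zero h2 hp) ?_ (by rw [hi]; ring) ?_ ?_ ?_ ?_ ?_ W ?_
  · have h4 : (4 : ZMod p) ≠ 0 := by
      rw [show (4 : ZMod p) = 2 * 2 by norm_num]
      exact mul_ne_zero h2 h2
    exact div_ne_zero (mul_ne_zero h4 he0) (mul_ne_zero hm hp)
  · field_simp; ring
  · rw [div_pow _ (_ * h), mul_pow _ h, hh]; field_simp; ring
  · rw [div_pow _ (_ * h), mul_pow _ h, hh, mul_pow, hm2]; field_simp; ring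
  · rw [div_pow (2 * m * _), mul_pow (2 * m), mul_pow 2 m, hm2]; field_simp; ring
  · have hprod : 2 * (e + 1) / ((e ^ 2 - 1) * h) * (2 * m / ((e ^ 2 - 1) * h)) *
        (2 * m * (e + 1) / ((e ^ 2 - 1) * (e ^ 2 + 1))) =
        8 * (e + 1) ^ 2 * m ^ 2 / ((e ^ 2 - 1) ^ 3 * h ^ 2 * (e ^ 2 + 1)) := by
      field_simp; ring
    rw [hprod, hm2, hh]
    field_simp
    ring
  · rw [hW, hA, hB, hfac]
    congr 1
    · field_simp; ring
    · field_simp; ring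
end

section
/- Let π be a prime and k ≥ 1 an integer. The number of matrices h ∈ GL₂(ℤ/π^{k+1}ℤ) such that h reduces to the identity in GL₂(ℤ/π^kℤ), h ≠ Id, and there exists a vector v ∈ (ℤ/π^{k+1}ℤ)² of additive order π^{k+1} with h·v = v, is exactly (π−1)(π+1)² = π⁴ − 1 − (π−1)²(π+1)π. -/
/-- In `ℤ/p^{k+1}ℤ`, multiplication by `p^k` annihilates exactly the multiples of `p`. -/
theorem ZMod.pow_mul_eq_zero_iff_castHom {p : ℕ} (hp : p.Prime) (k : ℕ)
    (z : ZMod (p ^ (k + 1))) :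
    (p : ZMod (p ^ (k + 1))) ^ k * z = 0 ↔
      ZMod.castHom (dvd_pow_self p k.succ_ne_zero) (ZMod p) z = 0 := by
  have : NeZero (p ^ (k + 1)) := ⟨(pow_pos hp.pos _).ne'⟩
  obtain ⟨n, rfl⟩ := ZMod.natCast_zmod_surjective z
  rw [map_natCast, ZMod.natCast_eq_zero_iff, ← Nat.cast_pow, ← Nat.cast_mul,
    ZMod.natCast_eq_zero_iff, pow_succ, Nat.mul_dvd_mul_iff_left (pow_pos hp.pos k)]

/-- The kernel of `ℤ/p^{k+1}ℤ → ℤ/p^kℤ` consists of the multiples of `p^k`. -/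
theorem ZMod.castHom_pow_eq_zero_iff {p : ℕ} (hp : p.Prime) (k : ℕ)
    (z : ZMod (p ^ (k + 1))) :
    ZMod.castHom (pow_dvd_pow p (Nat.le_succ k)) (ZMod (p ^ k)) z = 0 ↔
      ∃ y, z = (p : ZMod (p ^ (k + 1))) ^ k * y := by
  have : NeZero (p ^ (k + 1)) := ⟨(pow_pos hp.pos _).ne'⟩
  constructor
  · obtain ⟨n, rfl⟩ := ZMod.natCast_zmod_surjective z
    rw [map_natCast, ZMod.natCast_eq_zero_iff]
    rintro ⟨m, rfl⟩
    exact ⟨m, by push_cast; rfl⟩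
  · rintro ⟨y, rfl⟩
    rw [map_mul, map_pow, map_natCast, ← Nat.cast_pow, ZMod.natCast_self, zero_mul]

/-- A vector over `ℤ/p^{k+1}ℤ` has additive order `p^{k+1}` iff it is nonzero modulo `p`. -/
theorem ZMod.addOrderOf_pi_eq_pow_iff {ι : Type*} {p : ℕ} (hp : p.Prime) (k : ℕ)
    (v : ι → ZMod (p ^ (k + 1))) :
    addOrderOf v = p ^ (k + 1) ↔
      ZMod.castHom (dvd_pow_self p k.succ_ne_zero) (ZMod p) ∘ v ≠ 0 := by
  have : Fact p.Prime := ⟨hp⟩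
  have key : p ^ k • v = 0 ↔
      ZMod.castHom (dvd_pow_self p k.succ_ne_zero) (ZMod p) ∘ v = 0 := by
    rw [funext_iff, funext_iff]
    refine forall_congr' fun i => ?_
    rw [Pi.smul_apply, nsmul_eq_mul, Nat.cast_pow, Pi.zero_apply, Pi.zero_apply,
      ZMod.pow_mul_eq_zero_iff_castHom hp, Function.comp_apply]
  rw [Ne, ← key]
  constructor
  · intro h h0
    have := Nat.le_of_dvd (pow_pos hp.pos k) (h ▸ addOrderOf_dvd_of_nsmul_eq_zero h0)
    exact absurd this (not_le.2 (Nat.pow_lt_pow_right hp.one_lt k.lt_succ_self))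
  · intro h
    refine addOrderOf_eq_prime_pow h ?_
    ext i
    rw [Pi.smul_apply, nsmul_eq_mul, ZMod.natCast_self, zero_mul, Pi.zero_apply]

/-- The number of nonzero singular `2 × 2` matrices over a field with `p` elements. -/
theorem Matrix.card_ne_zero_det_eq_zero_fin_two {p : ℕ} (hp : p.Prime) :
    Nat.card {A : Matrix (Fin 2) (Fin 2) (ZMod p) | A ≠ 0 ∧ A.det = 0} =
      (p - 1) * (p + 1) ^ 2 := by
  have : Fact p.Prime := ⟨hp⟩
  have hGL : Nat.card {A : Matrix (Fin 2) (Fin 2) (ZMod p) | IsUnit A} =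
      (p ^ 2 - 1) * (p ^ 2 - p) := by
    have h := Matrix.card_GL_field (𝔽 := ZMod p) 2
    simp only [ZMod.card, Fin.prod_univ_two, Fin.val_zero, Fin.val_one, pow_zero, pow_one] at h
    rw [← h]
    exact (Nat.card_congr (Equiv.ofInjective _ Units.val_injective)).symm
  have hset : {A : Matrix (Fin 2) (Fin 2) (ZMod p) | A ≠ 0 ∧ A.det = 0} =
      {A | IsUnit A}ᶜ \ {0} := by
    ext A
    simp [Matrix.isUnit_iff_isUnit_det, and_comm]
  have htot := Set.ncard_add_ncard_compl {A : Matrix (Fin 2) (Fin 2) (ZMod p) | IsUnit A}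
  have hall : Nat.card (Matrix (Fin 2) (Fin 2) (ZMod p)) = p ^ 4 := by
    rw [Matrix, Nat.card_fun, Nat.card_fun]
    simp [← pow_mul]
  have hdiff := Set.ncard_sdiff_singleton_add_one
    (s := {A : Matrix (Fin 2) (Fin 2) (ZMod p) | IsUnit A}ᶜ) (a := 0) (by simp)
  rw [hall, ← Nat.card_coe_set_eq, hGL] at htot
  rw [hset, Nat.card_coe_set_eq]
  obtain ⟨m, rfl⟩ : ∃ m, p = m + 1 := ⟨p - 1, (Nat.succ_pred hp.ne_zero).symm⟩
  have h1 : (m + 1) ^ 2 - 1 = m ^ 2 + 2 * m := by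
    exact tsub_eq_of_eq_add (by ring)
  have h2 : (m + 1) ^ 2 - (m + 1) = m ^ 2 + m := by
    exact tsub_eq_of_eq_add (by ring)
  rw [h1, h2] at htot
  rw [Nat.add_sub_cancel]
  nlinarith

/-- A matrix over `ℤ/p^{k+1}ℤ` is annihilated by `p^k` iff it vanishes modulo `p`. -/
theorem Matrix.pow_smul_eq_zero_iff_map_castHom {m n : Type*} {p : ℕ} (hp : p.Prime) (k : ℕ)
    (B : Matrix m n (ZMod (p ^ (k + 1)))) :
    (p : ZMod (p ^ (k + 1))) ^ k • B = 0 ↔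
      B.map (ZMod.castHom (dvd_pow_self p k.succ_ne_zero) (ZMod p)) = 0 := by
  simp only [← Matrix.ext_iff, Matrix.smul_apply, smul_eq_mul, Matrix.zero_apply,
    Matrix.map_apply, ZMod.pow_mul_eq_zero_iff_castHom hp]

/-- For `k ≥ 1`, the matrix `1 + p^k B` over `ℤ/p^{k+1}ℤ` is invertible, with inverse
`1 - p^k B`. -/
def Matrix.oneAddPowSMul {p k : ℕ} (hk : 1 ≤ k)
    (B : Matrix (Fin 2) (Fin 2) (ZMod (p ^ (k + 1)))) :
    Matrix.GeneralLinearGroup (Fin 2) (ZMod (p ^ (k + 1))) :=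
  have h0 : (p : ZMod (p ^ (k + 1))) ^ k * (p : ZMod (p ^ (k + 1))) ^ k = 0 := by
    rw [← pow_add, ← Nat.cast_pow, ZMod.natCast_eq_zero_iff]
    exact pow_dvd_pow p (by lia)
  have h : ((p : ZMod (p ^ (k + 1))) ^ k • B) * ((p : ZMod (p ^ (k + 1))) ^ k • B) = 0 := by
    rw [Matrix.smul_mul, Matrix.mul_smul, smul_smul, h0, zero_smul]
  { val := 1 + (p : ZMod (p ^ (k + 1))) ^ k • B
    inv := 1 - (p : ZMod (p ^ (k + 1))) ^ k • B
    val_inv := by rw [add_mul, mul_sub, mul_sub, h]; simp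
    inv_val := by rw [sub_mul, mul_add, mul_add, h]; simp }

theorem Matrix.coe_oneAddPowSMul {p k : ℕ} (hk : 1 ≤ k)
    (B : Matrix (Fin 2) (Fin 2) (ZMod (p ^ (k + 1)))) :
    (Matrix.oneAddPowSMul hk B : Matrix (Fin 2) (Fin 2) (ZMod (p ^ (k + 1)))) =
      1 + (p : ZMod (p ^ (k + 1))) ^ k • B := rfl

theorem Matrix.oneAddPowSMul_eq_iff {p k : ℕ} (hp : p.Prime) (hk : 1 ≤ k)
    (B C : Matrix (Fin 2) (Fin 2) (ZMod (p ^ (k + 1)))) :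
    Matrix.oneAddPowSMul hk B = Matrix.oneAddPowSMul hk C ↔
      B.map (ZMod.castHom (dvd_pow_self p k.succ_ne_zero) (ZMod p)) =
        C.map (ZMod.castHom (dvd_pow_self p k.succ_ne_zero) (ZMod p)) := by
  rw [Units.ext_iff, Matrix.coe_oneAddPowSMul, Matrix.coe_oneAddPowSMul, add_right_inj,
    ← sub_eq_zero, ← smul_sub, Matrix.pow_smul_eq_zero_iff_map_castHom hp,
    Matrix.map_sub _ (map_sub _), sub_eq_zero]

theorem Matrix.oneAddPowSMul_eq_one_iff {p k : ℕ} (hp : p.Prime) (hk : 1 ≤ k)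
    (B : Matrix (Fin 2) (Fin 2) (ZMod (p ^ (k + 1)))) :
    Matrix.oneAddPowSMul hk B = 1 ↔
      B.map (ZMod.castHom (dvd_pow_self p k.succ_ne_zero) (ZMod p)) = 0 := by
  rw [Units.ext_iff, Matrix.coe_oneAddPowSMul, Units.val_one, add_eq_left,
    Matrix.pow_smul_eq_zero_iff_map_castHom hp]

theorem Matrix.GeneralLinearGroup.map_castHom_eq_one_iff {p k : ℕ} (hp : p.Prime) (hk : 1 ≤ k)
    (h : Matrix.GeneralLinearGroup (Fin 2) (ZMod (p ^ (k + 1)))) :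
    Matrix.GeneralLinearGroup.map
        (ZMod.castHom (pow_dvd_pow p (Nat.le_succ k)) (ZMod (p ^ k))) h = 1 ↔
      ∃ B, h = Matrix.oneAddPowSMul hk B := by
  have entries : Matrix.GeneralLinearGroup.map
        (ZMod.castHom (pow_dvd_pow p (Nat.le_succ k)) (ZMod (p ^ k))) h = 1 ↔
      ∀ i j, ∃ y, (h.val - 1) i j = (p : ZMod (p ^ (k + 1))) ^ k * y := by
    simp only [← ZMod.castHom_pow_eq_zero_iff hp, Matrix.sub_apply, map_sub, sub_eq_zero,
      Matrix.GeneralLinearGroup.ext_iff, Matrix.GeneralLinearGroup.map_apply]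
    refine forall₂_congr fun i j => ?_
    rw [Units.val_one, Matrix.one_apply, Matrix.one_apply, apply_ite (ZMod.castHom _ _), map_one,
      map_zero]
  rw [entries]
  constructor
  · intro H
    choose B hB using H
    refine ⟨Matrix.of B, Units.ext ?_⟩
    rw [Matrix.coe_oneAddPowSMul, ← sub_eq_iff_eq_add']
    ext i j
    exact hB i j
  · rintro ⟨B, rfl⟩ i j
    exact ⟨B i j, by rw [Matrix.coe_oneAddPowSMul, add_sub_cancel_left]; rfl⟩

theorem Matrix.exists_oneAddPowSMul_mulVec_eq_iff {p k : ℕ} (hp : p.Prime) (hk : 1 ≤ k)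
    (B : Matrix (Fin 2) (Fin 2) (ZMod (p ^ (k + 1)))) :
    (∃ v : Fin 2 → ZMod (p ^ (k + 1)), addOrderOf v = p ^ (k + 1) ∧
        Matrix.mulVec (Matrix.oneAddPowSMul hk B).val v = v) ↔
      (B.map (ZMod.castHom (dvd_pow_self p k.succ_ne_zero) (ZMod p))).det = 0 := by
  have : Fact p.Prime := ⟨hp⟩
  have fix (v : Fin 2 → ZMod (p ^ (k + 1))) :
      Matrix.mulVec (Matrix.oneAddPowSMul hk B).val v = v ↔
        Matrix.mulVec (B.map (ZMod.castHom (dvd_pow_self p k.succ_ne_zero) (ZMod p)))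
          (ZMod.castHom (dvd_pow_self p k.succ_ne_zero) (ZMod p) ∘ v) = 0 := by
    rw [Matrix.coe_oneAddPowSMul, Matrix.add_mulVec, Matrix.one_mulVec, add_eq_left,
      Matrix.smul_mulVec, funext_iff, funext_iff]
    refine forall_congr' fun i => ?_
    rw [Pi.smul_apply, smul_eq_mul, Pi.zero_apply, ZMod.pow_mul_eq_zero_iff_castHom hp,
      RingHom.map_mulVec, Pi.zero_apply]
  simp only [fix, ZMod.addOrderOf_pi_eq_pow_iff hp, ← Matrix.exists_mulVec_eq_zero_iff]
  constructor
  · rintro ⟨v, hv⟩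
    exact ⟨_, hv⟩
  · rintro ⟨w, hw⟩
    obtain ⟨v, rfl⟩ := (ZMod.castHom_surjective
      (dvd_pow_self p k.succ_ne_zero)).comp_left w
    exact ⟨v, hw⟩


/-- For a prime `π` and `k ≥ 1`, the number of matrices
`h ∈ GL₂(ℤ/π^{k+1}ℤ)` reducing to the identity modulo `π^k`, different from the identity,
and fixing some vector of additive order `π^{k+1}`, is `(π−1)(π+1)² = π⁴−1−(π−1)²(π+1)π`. -/
theorem card_lifts_of_identity_fixing_full_order_vector
    (π : ℕ) (hπ : π.Prime) (k : ℕ) (hk : 1 ≤ k) :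
    Nat.card {h : Matrix.GeneralLinearGroup (Fin 2) (ZMod (π ^ (k + 1))) |
      Matrix.GeneralLinearGroup.map
        (ZMod.castHom (pow_dvd_pow π (Nat.le_succ k)) (ZMod (π ^ k))) h = 1 ∧
      h ≠ 1 ∧
      ∃ v : Fin 2 → ZMod (π ^ (k + 1)),
        addOrderOf v = π ^ (k + 1) ∧
        Matrix.mulVec (↑h : Matrix (Fin 2) (Fin 2) (ZMod (π ^ (k + 1)))) v = v} =
      (π - 1) * (π + 1) ^ 2 ∧
    (π - 1) * (π + 1) ^ 2 = π ^ 4 - 1 - (π - 1) ^ 2 * (π + 1) * π := by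
 
  refine ⟨?_, ?_⟩
  · rw [← Matrix.card_ne_zero_det_eq_zero_fin_two hπ]
    set r := ZMod.castHom (dvd_pow_self π k.succ_ne_zero) (ZMod π) with hr
    have lift (A : Matrix (Fin 2) (Fin 2) (ZMod π)) :
        ∃ B : Matrix (Fin 2) (Fin 2) (ZMod (π ^ (k + 1))), B.map r = A :=
      ⟨A.map (Function.surjInv (ZMod.castHom_surjective (dvd_pow_self π k.succ_ne_zero))), by
        ext i j
        exact Function.surjInv_eq _ _⟩
    choose L hL using lift
    refine (Nat.card_congr (Set.BijOn.equiv (fun A => Matrix.oneAddPowSMul hk (L A))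
      ⟨?_, ?_, ?_⟩)).symm
    · rintro A ⟨hA, hdet⟩
      refine ⟨(Matrix.GeneralLinearGroup.map_castHom_eq_one_iff hπ hk _).2 ⟨_, rfl⟩, ?_, ?_⟩
      · rwa [Ne, Matrix.oneAddPowSMul_eq_one_iff hπ, ← hr, hL]
      · rwa [Matrix.exists_oneAddPowSMul_mulVec_eq_iff hπ, ← hr, hL]
    · intro A _ A' _ h
      rwa [Matrix.oneAddPowSMul_eq_iff hπ, ← hr, hL, hL] at h
    · rintro h ⟨hmap, hne, hfix⟩
      obtain ⟨B, rfl⟩ := (Matrix.GeneralLinearGroup.map_castHom_eq_one_iff hπ hk h).1 hmap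
      rw [Ne, Matrix.oneAddPowSMul_eq_one_iff hπ] at hne
      rw [Matrix.exists_oneAddPowSMul_mulVec_eq_iff hπ] at hfix
      exact ⟨B.map r, ⟨hne, hfix⟩, (Matrix.oneAddPowSMul_eq_iff hπ hk _ _).2 (hL _)⟩
  · obtain ⟨m, rfl⟩ : ∃ m, π = m + 1 := ⟨π - 1, (Nat.succ_pred hπ.ne_zero).symm⟩
    rw [Nat.add_sub_cancel, Nat.sub_sub]
    refine eq_tsub_of_add_eq ?_
    ring
end

section
/- Let π be a prime, k ≥ 1 an integer, and let g ∈ GL₂(ℤ/π^kℤ) with g ≠ Id be such that there exists a vector v ∈ (ℤ/π^kℤ)² of additive order π^k with g·v = v. Then the number of matrices h ∈ GL₂(ℤ/π^{k+1}ℤ) that reduce to g in GL₂(ℤ/π^kℤ) and fix some vector w ∈ (ℤ/π^{k+1}ℤ)² of additive order π^{k+1} is exactly π³. -/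
/-- The lifts of `g ∈ GL₂(ℤ/p^kℤ)` to `GL₂(ℤ/p^{k+1}ℤ)` that fix a vector of order `p^{k+1}`. -/
def fixingLifts (p k : ℕ) (g : Matrix.GeneralLinearGroup (Fin 2) (ZMod (p ^ k))) :
    Set (Matrix.GeneralLinearGroup (Fin 2) (ZMod (p ^ (k + 1)))) :=
  {h | Matrix.GeneralLinearGroup.map
        (ZMod.castHom (pow_dvd_pow p (Nat.le_succ k)) (ZMod (p ^ k))) h = g ∧
      ∃ w : Fin 2 → ZMod (p ^ (k + 1)),
        addOrderOf w = p ^ (k + 1) ∧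
        Matrix.mulVec (↑h : Matrix (Fin 2) (Fin 2) (ZMod (p ^ (k + 1)))) w = w}

theorem ZMod.natCast_pow_self (p n : ℕ) : (p : ZMod (p ^ n)) ^ n = 0 := by
  rw [← Nat.cast_pow]; exact ZMod.natCast_self _

theorem ZMod.isUnit_of_not_prime_dvd {p : ℕ} (hp : p.Prime) {n : ℕ} {a : ZMod (p ^ n)}
    (ha : ¬ (p : ZMod (p ^ n)) ∣ a) : IsUnit a := by
  obtain ⟨z, rfl⟩ := ZMod.intCast_surjective a
  have hz : ¬ (p : ℤ) ∣ z := by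
    rintro ⟨c, rfl⟩
    exact ha ⟨c, by push_cast; rfl⟩
  have hcop : IsCoprime ((p : ℤ) ^ n) z :=
    ((Nat.prime_iff_prime_int.mp hp).coprime_iff_not_dvd.mpr hz).pow_left
  obtain ⟨u, v, huv⟩ := hcop
  have h := congrArg (Int.cast : ℤ → ZMod (p ^ n)) huv
  push_cast at h
  rw [ZMod.natCast_pow_self, mul_zero, zero_add] at h
  exact IsUnit.of_mul_eq_one_right _ h

theorem ZMod.pow_dvd_of_pow_mul_eq_zero {p : ℕ} (hp : p.Prime) {i m n : ℕ} (hn : n = i + m)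
    {a : ZMod (p ^ n)} (ha : (p : ZMod (p ^ n)) ^ i * a = 0) :
    (p : ZMod (p ^ n)) ^ m ∣ a := by
  obtain ⟨z, rfl⟩ := ZMod.intCast_surjective a
  have h1 : (((p : ℤ) ^ i * z : ℤ) : ZMod (p ^ n)) = 0 := by push_cast; exact ha
  rw [ZMod.intCast_zmod_eq_zero_iff_dvd] at h1
  push_cast at h1
  rw [hn, pow_add] at h1
  obtain ⟨c, rfl⟩ := Int.dvd_of_mul_dvd_mul_left (pow_ne_zero _ (by exact_mod_cast hp.ne_zero)) h1
  exact ⟨c, by push_cast; rfl⟩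

theorem ZMod.castHom_prime_pow_eq_zero_iff_dvd {p k : ℕ} {a : ZMod (p ^ (k + 1))} :
    ZMod.castHom (pow_dvd_pow p (Nat.le_succ k)) (ZMod (p ^ k)) a = 0 ↔
      (p : ZMod (p ^ (k + 1))) ^ k ∣ a := by
  constructor
  · intro h
    obtain ⟨z, rfl⟩ := ZMod.intCast_surjective a
    rw [map_intCast, ZMod.intCast_zmod_eq_zero_iff_dvd] at h
    obtain ⟨c, rfl⟩ := h
    exact ⟨c, by push_cast; rfl⟩
  · rintro ⟨c, rfl⟩
    rw [map_mul, map_pow, map_natCast, ZMod.natCast_pow_self, zero_mul]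

theorem ZMod.castHom_prime_pow_eq_zero_iff_mul {p : ℕ} (hp : p.Prime) {k : ℕ}
    {a : ZMod (p ^ (k + 1))} :
    ZMod.castHom (pow_dvd_pow p (Nat.le_succ k)) (ZMod (p ^ k)) a = 0 ↔
      (p : ZMod (p ^ (k + 1))) * a = 0 := by
  rw [ZMod.castHom_prime_pow_eq_zero_iff_dvd]
  constructor
  · rintro ⟨c, rfl⟩
    rw [← mul_assoc, ← pow_succ', ZMod.natCast_pow_self, zero_mul]
  · intro h
    exact ZMod.pow_dvd_of_pow_mul_eq_zero hp (add_comm k 1) (by rwa [pow_one])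

theorem ZMod.isUnit_of_isUnit_castHom_prime_pow {p : ℕ} (hp : p.Prime) {k : ℕ} (hk : 1 ≤ k)
    {a : ZMod (p ^ (k + 1))}
    (ha : IsUnit (ZMod.castHom (pow_dvd_pow p (Nat.le_succ k)) (ZMod (p ^ k)) a)) :
    IsUnit a := by
  refine ZMod.isUnit_of_not_prime_dvd hp ?_
  rintro ⟨c, rfl⟩
  have : Fact (1 < p ^ k) := ⟨Nat.one_lt_pow (by omega) hp.one_lt⟩
  rw [map_mul, map_natCast] at ha
  have h2 := (isUnit_of_mul_isUnit_left ha).pow k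
  rw [ZMod.natCast_pow_self] at h2
  exact not_isUnit_zero h2

theorem ZMod.card_ker_castHom_prime_pow {p : ℕ} (hp : p.Prime) (k : ℕ) :
    Nat.card (RingHom.ker (ZMod.castHom (pow_dvd_pow p (Nat.le_succ k)) (ZMod (p ^ k)))) = p := by
  set f := ZMod.castHom (pow_dvd_pow p (Nat.le_succ k)) (ZMod (p ^ k))
  have h := f.toAddMonoidHom.ker.card_mul_index
  have hr : f.toAddMonoidHom.range = ⊤ :=
    AddMonoidHom.range_eq_top.mpr (ZMod.castHom_surjective (pow_dvd_pow p (Nat.le_succ k)))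
  rw [AddSubgroup.index_ker, hr, AddSubgroup.card_top, Nat.card_zmod, Nat.card_zmod] at h
  exact Nat.eq_of_mul_eq_mul_right (pow_pos hp.pos k) (h.trans (pow_succ' p k))

theorem ZMod.exists_not_dvd_of_addOrderOf_eq {p : ℕ} (hp : p.Prime) {n : ℕ} (hn : 1 ≤ n)
    {v : Fin 2 → ZMod (p ^ n)} (hv : addOrderOf v = p ^ n) :
    ¬ (p : ZMod (p ^ n)) ∣ v 0 ∨ ¬ (p : ZMod (p ^ n)) ∣ v 1 := by
  by_contra! hcon
  obtain ⟨m, rfl⟩ := Nat.exists_eq_add_of_le' hn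
  have h0 : p ^ m • v = 0 := by
    obtain ⟨⟨a, ha⟩, ⟨b, hb⟩⟩ := hcon
    ext i
    fin_cases i <;> simp only [Fin.zero_eta, Fin.mk_one, Pi.smul_apply, nsmul_eq_mul, ha, hb,
      Pi.zero_apply, Nat.cast_pow] <;>
      rw [← mul_assoc, ← pow_succ, ZMod.natCast_pow_self, zero_mul]
  have hdvd := addOrderOf_dvd_of_nsmul_eq_zero h0
  rw [hv] at hdvd
  exact absurd (Nat.pow_dvd_pow_iff_le_right hp.one_lt |>.mp hdvd) (by omega)

theorem ZMod.addOrderOf_eq_prime_pow_of_isUnit {p n : ℕ} {v : Fin 2 → ZMod (p ^ n)}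
    {i : Fin 2} (hv : IsUnit (v i)) : addOrderOf v = p ^ n := by
  apply Nat.dvd_antisymm
  · apply addOrderOf_dvd_of_nsmul_eq_zero
    ext j
    rw [Pi.smul_apply, nsmul_eq_mul, ZMod.natCast_self, zero_mul, Pi.zero_apply]
  · have h := congrFun (addOrderOf_nsmul_eq_zero v) i
    rw [Pi.smul_apply, nsmul_eq_mul, Pi.zero_apply, hv.mul_left_eq_zero] at h
    exact (ZMod.natCast_eq_zero_iff _ _).mp h

theorem Matrix.mulVec_eq_self_fin_two_iff {R : Type*} [CommRing R] {A : Matrix (Fin 2) (Fin 2) R}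
    {w : Fin 2 → R} :
    A.mulVec w = w ↔ A 0 0 * w 0 + A 0 1 * w 1 = w 0 ∧ A 1 0 * w 0 + A 1 1 * w 1 = w 1 := by
  simp [funext_iff, Fin.forall_fin_two]

theorem ZMod.exists_eq_pow_mul_not_dvd {p k : ℕ} {a b : ZMod (p ^ (k + 1))}
    (h : ¬ ((p : ZMod (p ^ (k + 1))) ^ k ∣ a ∧ (p : ZMod (p ^ (k + 1))) ^ k ∣ b)) :
    ∃ j < k, ∃ a' b' : ZMod (p ^ (k + 1)), a = p ^ j * a' ∧ b = p ^ j * b' ∧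
      (¬ (p : ZMod (p ^ (k + 1))) ∣ a' ∨ ¬ (p : ZMod (p ^ (k + 1))) ∣ b') := by
  classical
  have hex : ∃ i, ¬ ((p : ZMod (p ^ (k + 1))) ^ i ∣ a ∧ (p : ZMod (p ^ (k + 1))) ^ i ∣ b) :=
    ⟨k, h⟩
  have hle := Nat.find_min' hex h
  have hspec := Nat.find_spec hex
  have hmin := fun m => Nat.find_min hex (m := m)
  generalize Nat.find hex = i at hle hspec hmin
  cases i with
  | zero => simp at hspec
  | succ j =>
    obtain ⟨⟨a', ha⟩, ⟨b', hb⟩⟩ := not_not.mp (hmin j (Nat.lt_succ_self j))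
    refine ⟨j, hle, a', b', ha, hb, ?_⟩
    by_contra! hc
    refine hspec ⟨?_, ?_⟩
    · exact ha ▸ pow_succ (p : ZMod (p ^ (k + 1))) j ▸ mul_dvd_mul_left _ hc.1
    · exact hb ▸ pow_succ (p : ZMod (p ^ (k + 1))) j ▸ mul_dvd_mul_left _ hc.2

theorem Matrix.GeneralLinearGroup.card_fixingLifts_of_fixes_single {p : ℕ} (hp : p.Prime) {k : ℕ}
    (hk : 1 ≤ k) (g : Matrix.GeneralLinearGroup (Fin 2) (ZMod (p ^ k))) (hg : g ≠ 1)
    (h00 : g 0 0 = 1) (h10 : g 1 0 = 0) :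
    Nat.card (fixingLifts p k g) = p ^ 3 := by
  set f := ZMod.castHom (pow_dvd_pow p (Nat.le_succ k)) (ZMod (p ^ k)) with hf
  have hfp : ∀ a, f a = 0 ↔ (p : ZMod (p ^ (k + 1))) ^ k ∣ a := fun a =>
    ZMod.castHom_prime_pow_eq_zero_iff_dvd
  have hfm : ∀ a, f a = 0 ↔ (p : ZMod (p ^ (k + 1))) * a = 0 := fun a =>
    ZMod.castHom_prime_pow_eq_zero_iff_mul hp
  have hsurj : Function.Surjective f := ZMod.castHom_surjective _
  obtain ⟨β, hβ⟩ := hsurj (g 0 1)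
  obtain ⟨γ, hγ⟩ := hsurj (g 1 1 - 1)
  have hne : ¬ ((p : ZMod (p ^ (k + 1))) ^ k ∣ β ∧ (p : ZMod (p ^ (k + 1))) ^ k ∣ γ) := by
    rw [← hfp, ← hfp, hβ, hγ, sub_eq_zero]
    rintro ⟨hb, hd⟩
    apply hg
    ext i j
    fin_cases i <;> fin_cases j <;> simp [h00, h10, hb, hd]
  obtain ⟨j, hj, b, c, hb, hc, hbc⟩ := ZMod.exists_eq_pow_mul_not_dvd hne
  obtain ⟨u, v, huv⟩ : ∃ u v, u * b + v * c = 1 := by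
    rcases hbc with h | h <;> obtain ⟨e, he⟩ := (ZMod.isUnit_of_not_prime_dvd hp h).exists_left_inv
    · exact ⟨e, 0, by rw [he, zero_mul, add_zero]⟩
    · exact ⟨0, e, by rw [he, zero_mul, zero_add]⟩
  obtain ⟨m, rfl⟩ := Nat.exists_eq_add_of_lt hj
  let K := RingHom.ker f
  let M : K × K × K → Matrix (Fin 2) (Fin 2) (ZMod (p ^ (j + m + 1 + 1))) := fun x =>
    !![1 + x.1.1 * b, β + x.2.1.1; x.1.1 * c, 1 + γ + x.2.2.1]
  have hMg : ∀ x i l, f (M x i l) = g i l := by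
    rintro ⟨⟨a, ha⟩, ⟨s, hs⟩, ⟨r, hr⟩⟩ i l
    rw [RingHom.mem_ker] at ha hs hr
    fin_cases i <;> fin_cases l <;> simp [M, ha, hs, hr, h00, h10, hβ, hγ]
  have hMdet : ∀ x, IsUnit (M x).det := by
    intro x
    apply ZMod.isUnit_of_isUnit_castHom_prime_pow hp hk
    rw [← hf, RingHom.map_det]
    convert (Matrix.isUnit_iff_isUnit_det _).mp g.isUnit
    ext i l
    exact hMg x i l
  have hMfix : ∀ x, ∃ w, addOrderOf w = p ^ (j + m + 1 + 1) ∧ (M x).mulVec w = w := by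
    rintro ⟨⟨a, ha⟩, ⟨s, hs⟩, ⟨r, hr⟩⟩
    rw [RingHom.mem_ker] at ha hs hr
    obtain ⟨t, ht⟩ := (hfp a).mp ha
    rw [hfm] at hs hr
    refine ⟨![1, - (p ^ (m + 1) * t)], ?_, ?_⟩
    · exact ZMod.addOrderOf_eq_prime_pow_of_isUnit (i := 0) (by simp)
    · rw [Matrix.mulVec_eq_self_fin_two_iff]
      simp only [M, Matrix.of_apply, Matrix.cons_val_zero, Matrix.cons_val_one,
        Matrix.cons_val', Matrix.cons_val_fin_one, hb, hc]
      constructor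
      · linear_combination b * ht - p ^ m * t * hs
      · linear_combination c * ht - p ^ m * t * hr
  have hMinj : Function.Injective M := by
    rintro ⟨⟨a, ha⟩, ⟨s, hs⟩, ⟨r, hr⟩⟩ ⟨⟨a', ha'⟩, ⟨s', hs'⟩, ⟨r', hr'⟩⟩ h
    have e00 := congrFun (congrFun h 0) 0
    have e01 := congrFun (congrFun h 0) 1
    have e10 := congrFun (congrFun h 1) 0
    have e11 := congrFun (congrFun h 1) 1
    simp only [M, Matrix.of_apply, Matrix.cons_val_zero, Matrix.cons_val_one,
        Matrix.cons_val', Matrix.cons_val_fin_one, add_right_inj] at e00 e01 e10 e11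
    have e : a = a' := by
      linear_combination u * e00 + v * e10 - (a - a') * huv
    simp only [e, e01, e11]
  have hMsurj : ∀ h ∈ fixingLifts p (j + m + 1) g, ∃ x, M x = h.1 := by
    rintro h ⟨hh, w, hw, hwf⟩
    have hent : ∀ i l, f (h i l) = g i l := fun i l => by
      rw [← hh, Matrix.GeneralLinearGroup.map_apply]
    rw [Matrix.mulVec_eq_self_fin_two_iff] at hwf
    obtain ⟨hw1, hw2⟩ := hwf
    have hx : f (h 0 0 - 1) = 0 := by rw [map_sub, hent, h00, map_one, sub_self]
    have hy : f (h 1 0) = 0 := by rw [hent, h10]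
    have hs : f (h 0 1 - β) = 0 := by rw [map_sub, hent, hβ, sub_self]
    have hr : f (h 1 1 - 1 - γ) = 0 := by rw [map_sub, map_sub, hent, hγ, map_one, sub_self]
    have hx' := (hfm _).mp hx
    have hy' := (hfm _).mp hy
    have hs' := (hfm _).mp hs
    have hr' := (hfm _).mp hr
    have hpw : (p : ZMod (p ^ (j + m + 1 + 1))) ^ (j + 1) * w 1 = 0 := by
      linear_combination (-(p ^ (j + 1) * w 1)) * huv + p * u * hw1 + p * v * hw2
        - u * w 0 * hx' - v * w 0 * hy' - u * w 1 * hs' - v * w 1 * hr'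
        - p * w 1 * u * hb - p * w 1 * v * hc
    obtain ⟨t, ht⟩ := ZMod.pow_dvd_of_pow_mul_eq_zero hp (m := m + 1) (by omega) hpw
    have hw0 : ¬ (p : ZMod (p ^ (j + m + 1 + 1))) ∣ w 0 :=
      (ZMod.exists_not_dvd_of_addOrderOf_eq hp (by omega) hw).resolve_right
        (not_not.mpr ⟨p ^ m * t, by linear_combination ht⟩)
    obtain ⟨e, he⟩ := (ZMod.isUnit_of_not_prime_dvd hp hw0).exists_right_inv
    have ha : f (-(e * p ^ j * w 1)) = 0 := by
      rw [hfm]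
      linear_combination (-e) * hpw
    refine ⟨(⟨_, ha⟩, ⟨_, hs⟩, ⟨_, hr⟩), ?_⟩
    ext i l
    fin_cases i <;> fin_cases l <;>
      simp only [M, Matrix.of_apply, Matrix.cons_val_zero, Matrix.cons_val_one,
        Matrix.cons_val', Matrix.cons_val_fin_one, Fin.zero_eta, Fin.mk_one]
    · linear_combination (h 0 0 - 1) * he - e * hw1 + e * (h 0 1 - β) * ht + e * p ^ m * t * hs' +
        e * w 1 * hb
    · ring
    · linear_combination h 1 0 * he - e * hw2 + e * (h 1 1 - 1 - γ) * ht + e * p ^ m * t * hr' +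
        e * w 1 * hc
    · ring
  have hbij : Function.Bijective fun x : K × K × K =>
      (⟨Matrix.GeneralLinearGroup.mk'' (M x) (hMdet x), by
        refine ⟨?_, hMfix x⟩
        ext i l
        exact hMg x i l⟩ : fixingLifts p (j + m + 1) g) := by
    constructor
    · intro x y hxy
      exact hMinj (congrArg (fun h => h.1.1) hxy)
    · rintro ⟨h, hh⟩
      obtain ⟨x, hx⟩ := hMsurj h hh
      exact ⟨x, Subtype.ext (Units.ext hx)⟩
  rw [← Nat.card_congr (Equiv.ofBijective _ hbij), Nat.card_prod, Nat.card_prod,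
    ZMod.card_ker_castHom_prime_pow hp]
  ring

theorem fixingLifts_conj {p k : ℕ}
    (u : Matrix.GeneralLinearGroup (Fin 2) (ZMod (p ^ (k + 1))))
    (g : Matrix.GeneralLinearGroup (Fin 2) (ZMod (p ^ k)))
    {h : Matrix.GeneralLinearGroup (Fin 2) (ZMod (p ^ (k + 1)))} (hh : h ∈ fixingLifts p k g) :
    u * h * u⁻¹ ∈ fixingLifts p k
      (Matrix.GeneralLinearGroup.map
        (ZMod.castHom (pow_dvd_pow p (Nat.le_succ k)) (ZMod (p ^ k))) u * g *
      (Matrix.GeneralLinearGroup.map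
        (ZMod.castHom (pow_dvd_pow p (Nat.le_succ k)) (ZMod (p ^ k))) u)⁻¹) := by
  obtain ⟨rfl, w, hw, hwf⟩ := hh
  refine ⟨by simp only [map_mul, map_inv], u.1.mulVec w, ?_, ?_⟩
  · refine (addOrderOf_injective u.1.mulVecLin.toAddMonoidHom ?_ w).trans hw
    exact Matrix.mulVec_injective_of_isUnit u.isUnit
  · rw [Matrix.mulVec_mulVec, ← Units.val_mul, inv_mul_cancel_right, Units.val_mul,
      ← Matrix.mulVec_mulVec, hwf]

theorem card_fixingLifts_conj {p k : ℕ}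
    (u : Matrix.GeneralLinearGroup (Fin 2) (ZMod (p ^ (k + 1))))
    (g : Matrix.GeneralLinearGroup (Fin 2) (ZMod (p ^ k))) :
    Nat.card (fixingLifts p k
      (Matrix.GeneralLinearGroup.map
        (ZMod.castHom (pow_dvd_pow p (Nat.le_succ k)) (ZMod (p ^ k))) u * g *
      (Matrix.GeneralLinearGroup.map
        (ZMod.castHom (pow_dvd_pow p (Nat.le_succ k)) (ZMod (p ^ k))) u)⁻¹)) =
    Nat.card (fixingLifts p k g) := by
  refine (Nat.card_congr ((MulAut.conj u).toEquiv.subtypeEquiv fun h => ?_)).symm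
  refine ⟨fixingLifts_conj u g, fun hh => ?_⟩
  simpa [mul_assoc] using fixingLifts_conj u⁻¹ _ hh

theorem Matrix.GeneralLinearGroup.exists_col_zero_eq {R : Type*} [CommRing R] {v : Fin 2 → R}
    (hv : IsUnit (v 0) ∨ IsUnit (v 1)) :
    ∃ u : Matrix.GeneralLinearGroup (Fin 2) R, u.1.mulVec ![1, 0] = v := by
  rcases hv with hv | hv
  · refine ⟨Matrix.GeneralLinearGroup.mk'' !![v 0, 0; v 1, 1]
      (by simpa [Matrix.det_fin_two] using hv), ?_⟩
    change Matrix.mulVec (Matrix.of _) _ = v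
    ext i
    fin_cases i <;> simp
  · refine ⟨Matrix.GeneralLinearGroup.mk'' !![v 0, 1; v 1, 0]
      (by simpa [Matrix.det_fin_two] using hv), ?_⟩
    change Matrix.mulVec (Matrix.of _) _ = v
    ext i
    fin_cases i <;> simp


/-- For a prime `π`, `k ≥ 1`, and `g ∈ GL₂(ℤ/π^kℤ)` with `g ≠ Id` fixing
a vector of additive order `π^k`, the number of matrices `h ∈ GL₂(ℤ/π^{k+1}ℤ)` reducing to
`g` modulo `π^k` and fixing some vector of additive order `π^{k+1}` is exactly `π³`. -/
theorem card_lifts_fixing_full_order_vector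
    (π : ℕ) (hπ : π.Prime) (k : ℕ) (hk : 1 ≤ k)
    (g : Matrix.GeneralLinearGroup (Fin 2) (ZMod (π ^ k))) (hg : g ≠ 1)
    (hv : ∃ v : Fin 2 → ZMod (π ^ k),
      addOrderOf v = π ^ k ∧
      Matrix.mulVec (↑g : Matrix (Fin 2) (Fin 2) (ZMod (π ^ k))) v = v) :
    Nat.card {h : Matrix.GeneralLinearGroup (Fin 2) (ZMod (π ^ (k + 1))) |
      Matrix.GeneralLinearGroup.map
        (ZMod.castHom (pow_dvd_pow π (Nat.le_succ k)) (ZMod (π ^ k))) h = g ∧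
      ∃ w : Fin 2 → ZMod (π ^ (k + 1)),
        addOrderOf w = π ^ (k + 1) ∧
        Matrix.mulVec (↑h : Matrix (Fin 2) (Fin 2) (ZMod (π ^ (k + 1)))) w = w} =
      π ^ 3 := by
  change Nat.card (fixingLifts π k g) = π ^ 3
  obtain ⟨v, hv, hgv⟩ := hv
  set f := ZMod.castHom (pow_dvd_pow π (Nat.le_succ k)) (ZMod (π ^ k)) with hf
  have hsurj : Function.Surjective f := ZMod.castHom_surjective _
  choose s hs using hsurj
  have hunit : ∀ i, ¬ (π : ZMod (π ^ k)) ∣ v i → IsUnit (s (v i)) := fun i hi =>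
    ZMod.isUnit_of_isUnit_castHom_prime_pow hπ hk <| by
      rw [← hf, hs]; exact ZMod.isUnit_of_not_prime_dvd hπ hi
  obtain ⟨u, hu⟩ := Matrix.GeneralLinearGroup.exists_col_zero_eq (v := s ∘ v)
    ((ZMod.exists_not_dvd_of_addOrderOf_eq hπ hk hv).imp (hunit 0) (hunit 1))
  set U := Matrix.GeneralLinearGroup.map f u with hU
  have hUv : U.1.mulVec ![1, 0] = v := by
    ext i
    have h := congrArg f (congrFun hu i)
    rw [RingHom.map_mulVec, Function.comp_apply, hs] at h
    rw [← h]
    congr 2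
    ext l
    fin_cases l <;> simp
  have hfix : (U⁻¹ * g * U).1.mulVec ![1, 0] = ![1, 0] := by
    rw [Units.val_mul, Units.val_mul, ← Matrix.mulVec_mulVec, hUv, ← Matrix.mulVec_mulVec, hgv,
      ← hUv, Matrix.mulVec_mulVec, ← Units.val_mul, inv_mul_cancel, Units.val_one,
      Matrix.one_mulVec]
  have hcard := card_fixingLifts_conj u (U⁻¹ * g * U)
  rw [← hf, ← hU] at hcard
  rw [show U * (U⁻¹ * g * U) * U⁻¹ = g by group] at hcard
  rw [hcard]
  refine Matrix.GeneralLinearGroup.card_fixingLifts_of_fixes_single hπ hk _ ?_ ?_ ?_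
  · intro h
    apply hg
    rw [mul_assoc, inv_mul_eq_one] at h
    exact mul_eq_right.mp h.symm
  · simpa using congrFun hfix 0
  · simpa using congrFun hfix 1
end

section
/- Let x, y ∈ ℚ with y ≠ 0 and y² = x³ − 36x. Then x ∉ {0, 6, −6}, and setting t = (x+6)/(x−6) one has t ∉ {0, 1, −1} and 3(t² − 1)/(8t) = (3x/y)²; in other words, the parameter e = 3(t²−1)/(8t) produced from t by the rational parametrization of twisted Edwards curves with torsion ℤ/2ℤ × ℤ/4ℤ is a square of a rational number (e = g² with g = 3x/y), so the corresponding curve E_{−e⁴} belongs to the subfamily e = g². -/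
/-- If `x, y ∈ ℚ` with `y ≠ 0` and `y² = x³ − 36x`, then
`x ∉ {0, 6, −6}`, `t = (x+6)/(x−6)` satisfies `t ∉ {0, 1, −1}`, and the parameter
`e = 3(t²−1)/(8t)` is the square of the rational number `3x/y`. -/
theorem rank_one_curve_gives_square_parameter
    (x y : ℚ) (hy : y ≠ 0) (hxy : y ^ 2 = x ^ 3 - 36 * x)
    (t : ℚ) (ht : t = (x + 6) / (x - 6)) :
    x ≠ 0 ∧ x ≠ 6 ∧ x ≠ -6 ∧
    t ≠ 0 ∧ t ≠ 1 ∧ t ≠ -1 ∧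
    3 * (t ^ 2 - 1) / (8 * t) = (3 * x / y) ^ 2 := by
  have hx0 : x ≠ 0 := by
    rintro rfl
    exact hy (pow_eq_zero_iff two_ne_zero |>.mp (by linarith))
  have hx6 : x ≠ 6 := by
    rintro rfl
    exact hy (pow_eq_zero_iff two_ne_zero |>.mp (by linarith))
  have hx6' : x ≠ -6 := by
    rintro rfl
    exact hy (pow_eq_zero_iff two_ne_zero |>.mp (by linarith))
  have hsub : x - 6 ≠ 0 := sub_ne_zero.mpr hx6
  have hadd : x + 6 ≠ 0 := fun h => hx6' (eq_neg_of_add_eq_zero_left h)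
  subst ht
  refine ⟨hx0, hx6, hx6', div_ne_zero hadd hsub, ?_, ?_, ?_⟩
  · intro h
    rw [div_eq_one_iff_eq hsub] at h
    linarith
  · intro h
    rw [div_eq_iff hsub] at h
    exact hx0 (by linarith)
  · have hfac : x ^ 3 - 36 * x = x * ((x - 6) * (x + 6)) := by ring
    rw [div_pow (3 * x), hxy, hfac]
    field_simp
    ring
end

section
/- Let p > 3 be a prime and let A, B ∈ 𝔽_p satisfy B(A² − 4) ≠ 0. Let W_{A,B} be the elliptic curve Y² = X³ + (AB)X² + B²X over 𝔽_p. Suppose p ≡ 1 (mod 4) and that there exists c ∈ 𝔽_p with A + 2 = −Bc² (the Suyama-11 condition; necessarily c ≠ 0). Then the 4-torsion subgroup {P ∈ W_{A,B}(𝔽_p) : 4•P = O} is not isomorphic to ℤ/2ℤ × ℤ/2ℤ. -/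
open WeierstrassCurve

/-- If `A + 2 = Br²`, then the point `(B, B²r)` of `Y² = X³ + ABX² + B²X` doubles to the
`2`-torsion point `(0, 0)`, hence has order `4`. -/
lemma exists_four_nsmul_eq_zero_of_add_two_eq {F : Type*} [Field F] [DecidableEq F] (h2 : (2 : F) ≠ 0)
    {A B r : F} (hB : B ≠ 0) (hr : r ≠ 0) (hA : A + 2 = B * r ^ 2)
    (W : WeierstrassCurve F) (hW : W = ⟨0, A * B, 0, B ^ 2, 0⟩) :
    ∃ P : W.toAffine.Point, 4 • P = 0 ∧ 2 • P ≠ 0 := by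
  subst hW
  obtain rfl : A = B * r ^ 2 - 2 := by linear_combination hA
  have hy : (2 : F) * (B ^ 2 * r) ≠ 0 := mul_ne_zero h2 (mul_ne_zero (pow_ne_zero 2 hB) hr)
  set W : Affine F := ⟨0, (B * r ^ 2 - 2) * B, 0, B ^ 2, 0⟩ with hW
  have hns : W.Nonsingular B (B ^ 2 * r) := by
    rw [Affine.nonsingular_iff, Affine.equation_iff]
    refine ⟨by simp only [hW]; ring, Or.inr fun h => hy ?_⟩
    simp only [hW] at h
    linear_combination h
  have hne : B ^ 2 * r ≠ W.negY B (B ^ 2 * r) := fun h => hy <| by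
    simp only [Affine.negY, hW] at h
    linear_combination h
  have hslope : W.slope B B (B ^ 2 * r) (B ^ 2 * r) = B * r := by
    rw [Affine.slope_of_Y_ne rfl hne, div_eq_iff (sub_ne_zero.2 hne)]
    simp only [Affine.negY, hW]
    ring
  have hdouble := Affine.Point.add_self_of_Y_ne (h₁ := hns) hne
  refine ⟨.some _ _ hns, ?_, ?_⟩
  · rw [show 4 = 2 * 2 from rfl, mul_nsmul, two_nsmul (Affine.Point.some _ _ hns), hdouble,
      two_nsmul]
    apply Affine.Point.add_self_of_Y_eq
    simp only [hslope]
    simp only [Affine.addY, Affine.negAddY, Affine.addX, Affine.negY, hW]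
    ring
  · rw [two_nsmul, hdouble]
    exact Affine.Point.some_ne_zero _

/-- For a prime `p > 3` with `p ≡ 1 (mod 4)`, a Montgomery curve
(in Weierstrass form `Y² = X³ + (AB)X² + B²X`) satisfying the Suyama-11 condition
`A + 2 = −Bc²` has `4`-torsion subgroup not isomorphic to `ℤ/2ℤ × ℤ/2ℤ`. -/
theorem suyama11_four_torsion_not_Z2xZ2
    (p : ℕ) [Fact (Nat.Prime p)] (hp : 3 < p) (A B : ZMod p)
    (hAB : B * (A ^ 2 - 4) ≠ 0) (hp4 : p % 4 = 1)
    (hc : ∃ c : ZMod p, A + 2 = -(B * c ^ 2))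
    (W : WeierstrassCurve (ZMod p)) (hW : W = ⟨0, A * B, 0, B ^ 2, 0⟩) :
    ¬ Nonempty ((torsionSubgroup W.toAffine.Point 4) ≃+ (ZMod 2 × ZMod 2)) := by
  rintro ⟨e⟩
  obtain ⟨c, hc⟩ := hc
  obtain ⟨i, hi⟩ := ZMod.exists_sq_eq_neg_one_iff.2 (by lia : p % 4 ≠ 3)
  have h2 : (2 : ZMod p) ≠ 0 := fun h => by
    have := Nat.le_of_dvd two_pos ((ZMod.natCast_eq_zero_iff 2 p).1 (by exact_mod_cast h))
    lia
  have hA : A + 2 = B * (i * c) ^ 2 := by linear_combination hc + B * c ^ 2 * hi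
  have hr : i * c ≠ 0 := fun h => hAB <| by
    rw [h] at hA
    linear_combination B * (A - 2) * hA
  obtain ⟨P, hP4, hP2⟩ :=
    exists_four_nsmul_eq_zero_of_add_two_eq h2 (left_ne_zero_of_mul hAB) hr hA W hW
  have hT : 2 • (⟨P, hP4⟩ : torsionSubgroup W.toAffine.Point 4) = 0 := e.injective <| by
    rw [map_nsmul, map_zero]
    generalize e _ = x
    revert x
    decide
  exact hP2 (congrArg Subtype.val hT)
end
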